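/- Let μ be a singular cardinal and θ ≤ μ⁺ a cardinal. The following are equivalent: (1) pr₁(μ⁺, μ⁺, θ, cf(μ)) holds; (2) there is a function c : [μ⁺]² → θ such that for all unbounded subsets A and B of μ⁺ and every ς < θ, there are α ∈ A and β ∈ B with α < β and c({α, β}) = ς; (3) there is a function d : [μ⁺]² → θ such that for all stationary subsets S and T of μ⁺ and every ς < θ, there are α ∈ S and β ∈ T with α < β and d({α, β}) = ς. -/

import Mathlib

noncomputable section

open Set

/-- The successor cardinal of `mu`, as an ordinal. -/
def sucOrd (mu : Cardinal) : Ordinal := (Order.succ mu).ord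

/-- The cofinality of `mu`, as an ordinal. -/
def cofOrd (mu : Cardinal) : Ordinal := (Ordinal.cof mu.ord).ord

/-- `mu` is a singular cardinal: infinite, with cofinality smaller than itself. -/
def IsSingular (mu : Cardinal) : Prop :=
  Cardinal.aleph0 ≤ mu ∧ Ordinal.cof mu.ord < mu

/-- `C` is unbounded below `lam`. -/
def UnbddIn (C : Set Ordinal) (lam : Ordinal) : Prop :=
  ∀ x < lam, ∃ y ∈ C, x ≤ y ∧ y < lam

/-- `C` is closed below `lam`: any accumulation point below `lam` belongs to `C`. -/
def ClosedIn (C : Set Ordinal) (lam : Ordinal) : Prop :=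
  ∀ δ, δ < lam → 0 < δ → (∀ x < δ, ∃ y ∈ C, x < y ∧ y < δ) → δ ∈ C

/-- `C` is a closed unbounded subset of `lam`. -/
def IsClubIn (C : Set Ordinal) (lam : Ordinal) : Prop :=
  C ⊆ Set.Iio lam ∧ ClosedIn C lam ∧ UnbddIn C lam

/-- `S` is a stationary subset of `lam`: it meets every closed unbounded subset of `lam`. -/
def IsStatIn (S : Set Ordinal) (lam : Ordinal) : Prop :=
  S ⊆ Set.Iio lam ∧ ∀ C, IsClubIn C lam → (S ∩ C).Nonempty

/-- The set of ordinals `t` has cardinality `< kappa`. -/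
def CardLT (t : Set Ordinal) (kappa : Cardinal) : Prop :=
  (Cardinal.mk ↥t : Cardinal.{1}) < Cardinal.lift.{1, 0} kappa

/-- `c` witnesses Shelah's principle `pr₁(μ⁺, μ⁺, σ, cf μ)`: for every sequence
`⟨t_α : α < μ⁺⟩` of pairwise disjoint subsets of `μ⁺`, each of size `< cf μ`, and every
color `ε < σ`, there are `α < β < μ⁺` with `c` constantly `ε` on pairs from `t_α × t_β`. -/
def Pr1With (mu sigma : Cardinal) (c : Ordinal → Ordinal → Ordinal) : Prop :=
  (∀ a b, a < b → b < sucOrd mu → c a b < sigma.ord) ∧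
  ∀ t : Ordinal → Set Ordinal,
    (∀ a, a < sucOrd mu → t a ⊆ Set.Iio (sucOrd mu)) →
    (∀ a b, a < sucOrd mu → b < sucOrd mu → a ≠ b → Disjoint (t a) (t b)) →
    (∀ a, a < sucOrd mu → CardLT (t a) (Ordinal.cof mu.ord)) →
    ∀ ε, ε < sigma.ord →
      ∃ α β, α < β ∧ β < sucOrd mu ∧
        ∀ ξ ∈ t α, ∀ ζ ∈ t β, c (min ξ ζ) (max ξ ζ) = ε

/-- Shelah's principle `pr₁(μ⁺, μ⁺, σ, cf μ)`. -/
def Pr1 (mu sigma : Cardinal) : Prop := ∃ c, Pr1With mu sigma c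

/-- `(mus, f)` is a scale for the singular cardinal `mu`. -/
structure IsScale (mu : Cardinal) (mus : Ordinal → Cardinal)
    (f : Ordinal → Ordinal → Ordinal) : Prop where
  regular : ∀ i, i < cofOrd mu → (mus i).IsRegular
  strictMono : ∀ i j, i < j → j < cofOrd mu → mus i < mus j
  le_mu : ∀ i, i < cofOrd mu → mus i ≤ mu
  unbdd : ∀ θ, θ < mu → ∃ i, i < cofOrd mu ∧ θ < mus i
  cof_lt : Ordinal.cof mu.ord < mus 0
  f_lt : ∀ α, α < sucOrd mu → ∀ i, i < cofOrd mu → f α i < (mus i).ord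
  f_mono : ∀ α β, α < β → β < sucOrd mu →
    ∃ i0, i0 < cofOrd mu ∧ ∀ i, i0 ≤ i → i < cofOrd mu → f α i < f β i
  f_cofinal : ∀ g : Ordinal → Ordinal, (∀ i, i < cofOrd mu → g i < (mus i).ord) →
    ∃ α, α < sucOrd mu ∧ ∃ i0, i0 < cofOrd mu ∧ ∀ i, i0 ≤ i → i < cofOrd mu → g i < f α i

/-- The minimal walk from `b` down to `a` along the C-sequence `e`:
`walk e a b 0 = b` and `walk e a b (n+1) = min (e (walk e a b n) \ a)`,
staying at `a` once it is reached. -/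
def walk (e : Ordinal → Set Ordinal) (a b : Ordinal) : ℕ → Ordinal
  | 0 => b
  | n + 1 => if walk e a b n = a then a else sInf (e (walk e a b n) ∩ Set.Ici a)

/-- `ρ₂(a,b)`: the length of the minimal walk from `b` to `a`, i.e. the least `n`
with `walk e a b n = a`. -/
def rho2 (e : Ordinal → Set Ordinal) (a b : Ordinal) : ℕ :=
  sInf {n : ℕ | walk e a b n = a}

/-- `β_i⁻(a,b)`: zero for `i = 0`, and `sup (e_{β_j(a,b)} ∩ a)` for `i = j+1`. -/
def walkLow (e : Ordinal → Set Ordinal) (a b : Ordinal) : ℕ → Ordinal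
  | 0 => 0
  | j + 1 => sSup (e (walk e a b j) ∩ Set.Iio a)

/-- `γ(a,b) = β_{ρ₂(a,b)-1}(a,b)`, the last step before the walk reaches `a`. -/
def gammaW (e : Ordinal → Set Ordinal) (a b : Ordinal) : Ordinal :=
  walk e a b (rho2 e a b - 1)

/-- `γ⁻(a,b) = max {β_i⁻(a,b) : i < ρ₂(a,b)}`. -/
def gammaMinusW (e : Ordinal → Set Ordinal) (a b : Ordinal) : Ordinal :=
  sSup (walkLow e a b '' {i : ℕ | i < rho2 e a b})

/-- `η(a,b) = max {β_i⁻(a,b) : i ≤ ρ₂(a,b)}`. -/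
def etaW (e : Ordinal → Set Ordinal) (a b : Ordinal) : Ordinal :=
  sSup (walkLow e a b '' {i : ℕ | i ≤ rho2 e a b})

/-- `e` is a C-sequence on `lam`: each `e ξ` is closed unbounded in `ξ`. -/
def IsCSeq (e : Ordinal → Set Ordinal) (lam : Ordinal) : Prop :=
  ∀ ξ, ξ < lam → IsClubIn (e ξ) ξ

/-- `ξ` is an accumulation point of `C`: `ξ = sup (C ∩ ξ) > 0`. -/
def IsAccOf (C : Set Ordinal) (ξ : Ordinal) : Prop :=
  0 < ξ ∧ sSup (C ∩ Set.Iio ξ) = ξ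

/-- The non-accumulation points of `C`. -/
def naccOf (C : Set Ordinal) : Set Ordinal :=
  {ξ ∈ C | sSup (C ∩ Set.Iio ξ) < ξ}


section ColoringTransfer

open Cardinal Ordinal


/-! ### Sizes of sets of ordinals and cofinalities -/

/-- The set of ordinals `S` has cardinality at most `c`. -/
def SizeLE (S : Set Ordinal.{0}) (c : Cardinal.{0}) : Prop := #S ≤ Cardinal.lift.{1, 0} c

theorem SizeLE.mono {S T : Set Ordinal.{0}} {c d : Cardinal.{0}} (h : SizeLE S c) (hT : T ⊆ S)
    (hc : c ≤ d) : SizeLE T d :=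
  (mk_le_mk_of_subset hT).trans (h.trans (Cardinal.lift_le.2 hc))

theorem SizeLE.image {S : Set Ordinal.{0}} {c : Cardinal.{0}} (h : SizeLE S c)
    (f : Ordinal.{0} → Ordinal.{0}) : SizeLE (f '' S) c :=
  mk_image_le.trans h

theorem sizeLE_Iio (o : Ordinal.{0}) : SizeLE (Iio o) o.card := (Cardinal.mk_Iio_ordinal o).le

theorem sizeLE_Iio_ord (c : Cardinal.{0}) : SizeLE (Iio c.ord) c := by
  simpa using sizeLE_Iio c.ord

theorem sizeLE_singleton {x : Ordinal.{0}} {c : Cardinal.{0}} (hc : ℵ₀ ≤ c) : SizeLE {x} c := by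
  unfold SizeLE
  rw [mk_singleton]
  exact one_le_aleph0.trans (by simpa using hc)

theorem sizeLE_biUnion {I : Set Ordinal.{0}} {F : Ordinal.{0} → Set Ordinal.{0}} {c : Cardinal.{0}}
    (hc : ℵ₀ ≤ c) (hI : SizeLE I c) (hF : ∀ i ∈ I, SizeLE (F i) c) :
    SizeLE (⋃ i ∈ I, F i) c := by
  unfold SizeLE at *
  refine (mk_biUnion_le F I).trans ?_
  have hc' : ℵ₀ ≤ Cardinal.lift.{1, 0} c := by simpa using hc
  rw [← mul_eq_self hc']
  exact mul_le_mul' hI (ciSup_le' fun i => hF _ i.2)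

theorem sizeLE_union {S T : Set Ordinal.{0}} {c : Cardinal.{0}} (hc : ℵ₀ ≤ c)
    (hS : SizeLE S c) (hT : SizeLE T c) : SizeLE (S ∪ T) c := by
  unfold SizeLE at *
  have hc' : ℵ₀ ≤ Cardinal.lift.{1, 0} c := by simpa using hc
  refine (mk_union_le _ _).trans ?_
  rw [← add_eq_self hc']
  exact add_le_add hS hT

theorem sizeLE_iUnion_nat {F : ℕ → Set Ordinal.{0}} {c : Cardinal.{0}} (hc : ℵ₀ ≤ c)
    (hF : ∀ n, SizeLE (F n) c) : SizeLE (⋃ n, F n) c := by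
  unfold SizeLE at *
  have hc' : ℵ₀ ≤ Cardinal.lift.{1, 0} c := by simpa using hc
  have h := mk_iUnion_le_lift F
  simp only [Cardinal.lift_uzero, mk_nat, Cardinal.lift_aleph0] at h
  refine h.trans ?_
  rw [← mul_eq_self hc']
  exact mul_le_mul' hc' (ciSup_le' fun i => hF i)

theorem SizeLE.lt_cof {S : Set Ordinal.{0}} {c : Cardinal.{0}} (h : SizeLE S c) {o : Ordinal.{0}}
    (ho : c < o.cof) : #S < Cardinal.lift.{1, 0} o.cof :=
  lt_of_le_of_lt h (Cardinal.lift_lt.2 ho)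

theorem exists_bound_of_lt_cof {S : Set Ordinal.{0}} {o : Ordinal.{0}}
    (hS : #S < Cardinal.lift.{1, 0} o.cof) (h : ∀ x ∈ S, x < o) : ∃ b < o, ∀ x ∈ S, x < b := by
  rw [lift_cof] at hS
  refine ⟨_, sSup_add_one_lt_of_lt_cof hS h, fun x hx => ?_⟩
  have hb : BddAbove ((· + 1) '' S) :=
    ⟨o, by rintro _ ⟨y, hy, rfl⟩; exact Order.add_one_le_of_lt (h y hy)⟩
  exact (Order.lt_add_one_iff.2 le_rfl).trans_le (le_csSup hb ⟨x, hx, rfl⟩)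

theorem SizeLE.exists_bound {S : Set Ordinal.{0}} {c : Cardinal.{0}} (hS : SizeLE S c)
    {o : Ordinal.{0}} (ho : c < o.cof) (h : ∀ x ∈ S, x < o) : ∃ b < o, ∀ x ∈ S, x < b :=
  exists_bound_of_lt_cof (hS.lt_cof ho) h

/-- Pointwise bounds over a small index set have a common bound. -/
theorem SizeLE.exists_bound_image {S : Set Ordinal.{0}} {c : Cardinal.{0}} (hS : SizeLE S c)
    {o : Ordinal.{0}} (ho : c < o.cof) {f : Ordinal.{0} → Ordinal.{0}} (h : ∀ x ∈ S, f x < o) :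
    ∃ b < o, ∀ x ∈ S, f x < b := by
  obtain ⟨b, hb, hb'⟩ := (hS.image f).exists_bound ho (by rintro _ ⟨x, hx, rfl⟩; exact h x hx)
  exact ⟨b, hb, fun x hx => hb' _ ⟨x, hx, rfl⟩⟩

theorem SizeLE.exists_bound_choice {S : Set Ordinal.{0}} {c : Cardinal.{0}} (hS : SizeLE S c)
    {o : Ordinal.{0}} (ho : c < o.cof) {P : Ordinal.{0} → Ordinal.{0} → Prop}
    (h : ∀ x ∈ S, ∃ y < o, P x y) :
    ∃ b < o, ∀ x ∈ S, ∃ y < b, P x y := by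
  choose! f hf hP using h
  obtain ⟨b, hb, hb'⟩ := hS.exists_bound_image ho hf
  exact ⟨b, hb, fun x hx => ⟨f x, hb' x hx, hP x hx⟩⟩

/-- A fixed cofinal subset of `o` of size `cof o`. -/
theorem exists_ladder (o : Ordinal.{0}) :
    ∃ e : Set Ordinal.{0}, e ⊆ Iio o ∧ SizeLE e o.cof ∧ ∀ x < o, ∃ y ∈ e, x ≤ y := by
  obtain ⟨s, hs, hc⟩ := Order.exists_cof_eq (Iio o)
  refine ⟨Subtype.val '' s, ?_, ?_, fun x hx => ?_⟩
  · rintro _ ⟨x, _, rfl⟩; exact x.2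
  · unfold SizeLE
    rw [lift_cof, ← cof_Iio, ← hc]
    exact mk_image_le
  · obtain ⟨y, hy, hxy⟩ := hs ⟨x, hx⟩
    exact ⟨y, ⟨y, hy, rfl⟩, hxy⟩

/-- A ladder: a cofinal subset of `o` of size `cof o`. -/
def ladder (o : Ordinal.{0}) : Set Ordinal.{0} := (exists_ladder o).choose

theorem ladder_subset (o : Ordinal.{0}) : ladder o ⊆ Iio o := (exists_ladder o).choose_spec.1

theorem sizeLE_ladder (o : Ordinal.{0}) : SizeLE (ladder o) o.cof := (exists_ladder o).choose_spec.2.1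

theorem exists_mem_ladder {o x : Ordinal.{0}} (h : x < o) : ∃ y ∈ ladder o, x ≤ y :=
  (exists_ladder o).choose_spec.2.2 x h

theorem cof_le_of_unbounded {S : Set Ordinal.{0}} {c : Cardinal.{0}} (hS : SizeLE S c)
    {o : Ordinal.{0}} (h : ∀ x ∈ S, x < o) (hu : ∀ b < o, ∃ x ∈ S, b ≤ x) : o.cof ≤ c := by
  by_contra! hlt
  obtain ⟨b, hb, hb'⟩ := hS.exists_bound hlt h
  obtain ⟨x, hx, hbx⟩ := hu b hb
  exact absurd (hb' x hx) hbx.not_gt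

/-- Pigeonhole: if fewer than `cof o` pieces cover an unbounded set, one of them is unbounded. -/
theorem exists_unbounded_fiber {U I : Set Ordinal.{0}} {c : Cardinal.{0}} (hI : SizeLE I c)
    {o : Ordinal.{0}} (ho : c < o.cof) (hU : ∀ b < o, ∃ x ∈ U, b ≤ x ∧ x < o)
    {P : Ordinal.{0} → Ordinal.{0} → Prop} (hP : ∀ x ∈ U, x < o → ∃ i ∈ I, P x i) :
    ∃ i ∈ I, ∀ b < o, ∃ x ∈ U, b ≤ x ∧ x < o ∧ P x i := by
  by_contra! hcon
  obtain ⟨b, hb, hb'⟩ := hI.exists_bound_choice ho hcon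
  obtain ⟨x, hx, hbx, hxo⟩ := hU b hb
  obtain ⟨i, hi, hPi⟩ := hP x hx hxo
  obtain ⟨y, hy, hy'⟩ := hb' i hi
  exact hy' x hx (hy.le.trans hbx) hxo hPi

theorem succ_lt_of_aleph0_le_cof {o x : Ordinal.{0}} (ho : ℵ₀ ≤ o.cof) (hx : x < o) : x + 1 < o :=
  (one_lt_cof_iff.1 (one_lt_aleph0.trans_le ho)).add_one_lt hx

theorem pos_of_aleph0_le_cof {o : Ordinal.{0}} (ho : ℵ₀ ≤ o.cof) : 0 < o :=
  (one_lt_cof_iff.1 (one_lt_aleph0.trans_le ho)).bot_lt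

/-- Recursion choosing a value that may depend on all earlier values. -/
theorem exists_rec {X : Type*} [Nonempty X] (R : Ordinal.{0} → (Ordinal.{0} → X) → X → Prop)
    (hex : ∀ ξ G, ∃ b, R ξ G b)
    (hcongr : ∀ ξ G G' b, (∀ η < ξ, G η = G' η) → R ξ G b → R ξ G' b) :
    ∃ G : Ordinal.{0} → X, ∀ ξ, R ξ G (G ξ) := by
  classical
  choose F hF using hex
  let x0 : X := Classical.arbitrary X
  let G : Ordinal.{0} → X := WellFoundedLT.fix (motive := fun _ => X)
    fun ξ ih => F ξ fun η => if h : η < ξ then ih η h else x0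
  refine ⟨G, fun ξ => ?_⟩
  have hG : G ξ = F ξ fun η => if η < ξ then G η else x0 := by
    have := WellFoundedLT.fix_eq (motive := fun _ => X)
      (fun ξ ih => F ξ fun η => if h : η < ξ then ih η h else x0) ξ
    simpa [G] using this
  rw [hG]
  refine hcongr ξ _ G _ (fun η hη => by simp [hη]) (hF ξ _)

/-- A decreasing sequence of ordinals stabilizes. -/
theorem exists_stable (v : Ordinal.{0} → Ordinal.{0}) {o : Ordinal.{0}} (ho : 0 < o)
    (hv : ∀ k l, k ≤ l → l < o → v l ≤ v k) :
    ∃ k0 < o, ∀ k, k0 ≤ k → k < o → v k = v k0 := by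
  have hne : (v '' Iio o).Nonempty := ⟨_, 0, ho, rfl⟩
  obtain ⟨k0, hk0, hk⟩ := csInf_mem hne
  refine ⟨k0, hk0, fun k hle hlt => le_antisymm (hv _ _ hle hlt) ?_⟩
  rw [hk]
  exact csInf_le' ⟨k, hlt, rfl⟩

/-! ### Club sets -/

theorem ClosedIn.sSup_mem {E S : Set Ordinal.{0}} {lam z : Ordinal.{0}} (hE : ClosedIn E lam)
    (hS : S ⊆ E) (hne : S.Nonempty) (hz : ∀ x ∈ S, x ≤ z) (hzl : z < lam) : sSup S ∈ E := by
  by_cases hmem : sSup S ∈ S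
  · exact hS hmem
  have hb : BddAbove S := ⟨z, hz⟩
  have hlt : ∀ x ∈ S, x < sSup S := fun x hx =>
    lt_of_le_of_ne (le_csSup hb hx) fun h => hmem (h ▸ hx)
  obtain ⟨x0, hx0⟩ := hne
  refine hE _ ((csSup_le ⟨x0, hx0⟩ hz).trans_lt hzl) (bot_le.trans_lt (hlt _ hx0)) fun x hx => ?_
  obtain ⟨y, hy, hxy⟩ := exists_lt_of_lt_csSup ⟨x0, hx0⟩ hx
  exact ⟨y, hS hy, hxy, hlt y hy⟩

theorem exists_omega_limit {lam : Ordinal.{0}} (hlam : ℵ₀ < lam.cof)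
    {P : Ordinal.{0} → Ordinal.{0} → Prop} (hP : ∀ x < lam, ∃ y, x < y ∧ y < lam ∧ P x y)
    {x0 : Ordinal.{0}} (hx0 : x0 < lam) :
    ∃ δ < lam, x0 < δ ∧ ∀ x < δ, ∃ z w, x ≤ z ∧ z < w ∧ w < δ ∧ P z w := by
  choose! F hF1 hF2 hF3 using hP
  let s : ℕ → Ordinal.{0} := fun n => F^[n] x0
  have hs : ∀ n, s (n + 1) = F (s n) := fun n => Function.iterate_succ_apply' F n x0
  have hsl : ∀ n, s n < lam := fun n => by
    induction n with
    | zero => exact hx0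
    | succ n ih => rw [hs]; exact hF2 _ ih
  have hinc : ∀ n, s n < s (n + 1) := fun n => by rw [hs]; exact hF1 _ (hsl n)
  have hb : BddAbove (range s) := ⟨lam, by rintro _ ⟨n, rfl⟩; exact (hsl n).le⟩
  have hlt : ∀ n, s n < sSup (range s) := fun n => (hinc n).trans_le (le_csSup hb ⟨n + 1, rfl⟩)
  refine ⟨sSup (range s), sSup_lt_of_lt_cof ?_ ?_, hlt 0, fun x hx => ?_⟩
  · refine lt_of_le_of_lt (b := ℵ₀) (mk_le_aleph0_iff.2 (countable_range s)) ?_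
    rw [← lift_cof, ← Cardinal.lift_aleph0.{1, 0}]
    exact Cardinal.lift_lt.2 hlam
  · rintro _ ⟨n, rfl⟩; exact hsl n
  · obtain ⟨_, ⟨n, rfl⟩, hn⟩ := exists_lt_of_lt_csSup ⟨_, mem_range_self 0⟩ hx
    exact ⟨s n, s (n + 1), hn.le, hinc n, hlt _, by rw [hs]; exact hF3 _ (hsl n)⟩

section Regular

variable {c : Cardinal.{0}}

theorem cof_ord_lt (hc : c.IsRegular) {x : Ordinal.{0}} (hx : x < c.ord) :
    x.card < c.ord.cof := by
  rw [hc.cof_ord]; exact lt_ord.1 hx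

theorem IsClubIn.exists_gt (hc : c.IsRegular) {C : Set Ordinal.{0}}
    (hC : IsClubIn C c.ord) {x : Ordinal.{0}} (hx : x < c.ord) : ∃ y ∈ C, x < y ∧ y < c.ord := by
  obtain ⟨y, hy, hxy, hyl⟩ := hC.2.2 (x + 1)
    (succ_lt_of_aleph0_le_cof (by rw [hc.cof_ord]; exact hc.aleph0_le) hx)
  exact ⟨y, hy, Order.add_one_le_iff.1 hxy, hyl⟩

theorem isClubIn_Iio (c : Cardinal.{0}) : IsClubIn (Iio c.ord) c.ord :=
  ⟨subset_rfl, fun _ h _ _ => h, fun x hx => ⟨x, hx, le_rfl, hx⟩⟩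

theorem isClubIn_Ioo (hc : c.IsRegular) {b : Ordinal.{0}} (hb : b < c.ord) :
    IsClubIn (Ioo b c.ord) c.ord := by
  refine ⟨fun y hy => hy.2, fun δ hδ h0 h => ?_, fun x hx => ?_⟩
  · obtain ⟨y, hy, _, hyδ⟩ := h 0 h0
    exact ⟨hy.1.trans hyδ, hδ⟩
  · obtain ⟨y, _, hy, hyl⟩ := (isClubIn_Iio c).exists_gt hc (max_lt hx hb)
    exact ⟨y, ⟨(le_max_right _ _).trans_lt hy, hyl⟩, ((le_max_left _ _).trans_lt hy).le, hyl⟩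

theorem isClubIn_biInter (hc : c.IsRegular) (hu : ℵ₀ < c) {I : Set Ordinal.{0}} {d : Cardinal.{0}}
    (hI : SizeLE I d) (hd : d < c) {C : Ordinal.{0} → Set Ordinal.{0}}
    (hC : ∀ i ∈ I, IsClubIn (C i) c.ord) : IsClubIn {y | y < c.ord ∧ ∀ i ∈ I, y ∈ C i} c.ord := by
  refine ⟨fun y hy => hy.1, fun δ hδ h0 h => ⟨hδ, fun i hi => ?_⟩, fun x hx => ?_⟩
  · refine (hC i hi).2.1 δ hδ h0 fun x hx => ?_
    obtain ⟨y, hy, hxy⟩ := h x hx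
    exact ⟨y, hy.2 i hi, hxy⟩
  · obtain ⟨δ, hδ, hxδ, h⟩ := exists_omega_limit (lam := c.ord)
      (P := fun x y => ∀ i ∈ I, ∃ z ∈ C i, x < z ∧ z < y) (by rwa [hc.cof_ord])
      (fun x hx => by
        obtain ⟨b, hb, hb'⟩ := hI.exists_bound_choice (o := c.ord) (by rwa [hc.cof_ord])
          (P := fun i z => z ∈ C i ∧ x < z) fun i hi => by
            obtain ⟨z, hz, hxz, hzl⟩ := (hC i hi).exists_gt hc hx
            exact ⟨z, hzl, hz, hxz⟩
        obtain ⟨y, _, hy, hyl⟩ := (isClubIn_Iio c).exists_gt hc (max_lt hx hb)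
        refine ⟨y, (le_max_left _ _).trans_lt hy, hyl, fun i hi => ?_⟩
        obtain ⟨z, hz, hzC, hxz⟩ := hb' i hi
        exact ⟨z, hzC, hxz, hz.trans ((le_max_right _ _).trans_lt hy)⟩) hx
    refine ⟨δ, ⟨hδ, fun i hi => ?_⟩, hxδ.le, hδ⟩
    refine (hC i hi).2.1 δ hδ (bot_le.trans_lt hxδ) fun x' hx' => ?_
    obtain ⟨z, w, hxz, _, hw, hP⟩ := h x' hx'
    obtain ⟨y, hy, hzy, hyw⟩ := hP i hi
    exact ⟨y, hy, hxz.trans_lt hzy, hyw.trans hw⟩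

theorem isClubIn_diag (hc : c.IsRegular) (hu : ℵ₀ < c) {C : Ordinal.{0} → Set Ordinal.{0}}
    (hC : ∀ i < c.ord, IsClubIn (C i) c.ord) :
    IsClubIn {y | y < c.ord ∧ ∀ i < y, y ∈ C i} c.ord := by
  refine ⟨fun y hy => hy.1, fun δ hδ h0 h => ⟨hδ, fun i hi => ?_⟩, fun x hx => ?_⟩
  · refine (hC i (hi.trans hδ)).2.1 δ hδ h0 fun x hx => ?_
    obtain ⟨y, hy, hxy, hyδ⟩ := h (max i x) (max_lt hi hx)
    exact ⟨y, hy.2 i ((le_max_left _ _).trans_lt hxy), (le_max_right _ _).trans_lt hxy, hyδ⟩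
  · obtain ⟨δ, hδ, hxδ, h⟩ := exists_omega_limit (lam := c.ord)
      (P := fun x y => ∀ i ≤ x, ∃ z ∈ C i, x < z ∧ z < y) (by rwa [hc.cof_ord])
      (fun x hx => by
        have hx1 := succ_lt_of_aleph0_le_cof (by rw [hc.cof_ord]; exact hc.aleph0_le) hx
        obtain ⟨b, hb, hb'⟩ := (sizeLE_Iio (x + 1)).exists_bound_choice (cof_ord_lt hc hx1)
          (P := fun i z => z ∈ C i ∧ x < z) fun i hi => by
            obtain ⟨z, hz, hxz, hzl⟩ := (hC i (hi.trans hx1)).exists_gt hc hx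
            exact ⟨z, hzl, hz, hxz⟩
        obtain ⟨y, _, hy, hyl⟩ := (isClubIn_Iio c).exists_gt hc (max_lt hx hb)
        refine ⟨y, (le_max_left _ _).trans_lt hy, hyl, fun i hi => ?_⟩
        obtain ⟨z, hz, hzC, hxz⟩ := hb' i (Order.lt_add_one_iff.2 hi)
        exact ⟨z, hzC, hxz, hz.trans ((le_max_right _ _).trans_lt hy)⟩) hx
    refine ⟨δ, ⟨hδ, fun i hi => ?_⟩, hxδ.le, hδ⟩
    refine (hC i (hi.trans hδ)).2.1 δ hδ (bot_le.trans_lt hxδ) fun x' hx' => ?_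
    obtain ⟨z, w, hxz, _, hw, hP⟩ := h (max i x') (max_lt hi hx')
    obtain ⟨y, hy, hzy, hyw⟩ := hP i ((le_max_left _ _).trans hxz)
    exact ⟨y, hy, (le_max_right _ _).trans_lt (hxz.trans_lt hzy), hyw.trans hw⟩

theorem IsClubIn.inter (hc : c.IsRegular) (hu : ℵ₀ < c) {C D : Set Ordinal.{0}}
    (hC : IsClubIn C c.ord) (hD : IsClubIn D c.ord) : IsClubIn (C ∩ D) c.ord := by
  have h := isClubIn_biInter hc hu (I := Iio 2) (sizeLE_Iio 2)
    (by simpa using (natCast_lt_aleph0 (n := 2)).trans hu) (C := fun i => if i = 0 then C else D)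
    (fun i _ => by split_ifs <;> assumption)
  convert h using 1
  ext y
  constructor
  · rintro ⟨h1, h2⟩
    refine ⟨hC.1 h1, fun i _ => ?_⟩
    split_ifs <;> assumption
  · rintro ⟨_, h⟩
    exact ⟨by simpa using h 0 (by simp), by simpa using h 1 (by simp)⟩

theorem isClubIn_closure_points (hc : c.IsRegular) (hu : ℵ₀ < c) {F : Ordinal.{0} → Ordinal.{0}}
    (hF : ∀ x < c.ord, F x < c.ord) : IsClubIn {y | y < c.ord ∧ ∀ x < y, F x < y} c.ord := by
  have h := isClubIn_diag hc hu (C := fun x => Ioo (F x) c.ord) fun i hi => isClubIn_Ioo hc (hF i hi)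
  convert h using 1
  ext y
  exact ⟨fun h => ⟨h.1, fun x hx => ⟨h.2 x hx, h.1⟩⟩, fun h => ⟨h.1, fun x hx => (h.2 x hx).1⟩⟩

theorem IsStatIn.inter_club (hc : c.IsRegular) (hu : ℵ₀ < c) {S C : Set Ordinal.{0}}
    (hS : IsStatIn S c.ord) (hC : IsClubIn C c.ord) : IsStatIn (S ∩ C) c.ord := by
  refine ⟨fun y hy => hS.1 hy.1, fun D hD => ?_⟩
  rw [inter_assoc]
  exact hS.2 _ (hC.inter hc hu hD)

theorem IsStatIn.unbddIn (hc : c.IsRegular) {S : Set Ordinal.{0}}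
    (hS : IsStatIn S c.ord) : UnbddIn S c.ord := by
  intro x hx
  obtain ⟨y, hy, hy'⟩ := hS.2 _ (isClubIn_Ioo hc hx)
  exact ⟨y, hy, hy'.1.le, hy'.2⟩

end Regular

/-- Enumerating an unbounded set increasingly. -/
theorem exists_increasing {lam ρ : Ordinal.{0}} (hρ : ∀ ξ < ρ, ξ.card < lam.cof)
    {U : Set Ordinal.{0}} (hU : ∀ x < lam, ∃ y ∈ U, x < y ∧ y < lam) :
    ∃ h : Ordinal.{0} → Ordinal.{0}, (∀ ξ < ρ, h ξ ∈ U ∧ h ξ < lam) ∧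
      ∀ η ξ, η < ξ → ξ < ρ → h η < h ξ := by
  obtain ⟨h, hh⟩ := exists_rec (X := Ordinal.{0})
    (fun ξ G b => ξ < ρ → (∀ η < ξ, G η < lam) → (b ∈ U ∧ b < lam) ∧ ∀ η < ξ, G η < b)
    (fun ξ G => by
      by_cases h : ξ < ρ ∧ ∀ η < ξ, G η < lam
      · obtain ⟨b, hb, hb'⟩ := (sizeLE_Iio ξ).exists_bound_image (hρ ξ h.1) (f := G) h.2
        obtain ⟨y, hy, hby, hyl⟩ := hU b hb
        exact ⟨y, fun _ _ => ⟨⟨hy, hyl⟩, fun η hη => (hb' η hη).trans hby⟩⟩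
      · exact ⟨0, fun h1 h2 => absurd ⟨h1, h2⟩ h⟩)
    (fun ξ G G' b hG hb h1 h2 => by
      obtain ⟨h3, h4⟩ := hb h1 fun η hη => by rw [hG η hη]; exact h2 η hη
      exact ⟨h3, fun η hη => by rw [← hG η hη]; exact h4 η hη⟩)
  have key : ∀ ξ, ξ < ρ → h ξ < lam := by
    intro ξ
    induction ξ using WellFoundedLT.induction with
    | ind ξ ih => exact fun hξ => (hh ξ hξ fun η hη => ih η hη (hη.trans hξ)).1.2
  exact ⟨h, fun ξ hξ => (hh ξ hξ fun η hη => key η (hη.trans hξ)).1,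
    fun η ξ hηξ hξ => (hh ξ hξ fun η hη => key η (hη.trans hξ)).2 η hηξ⟩

theorem IsClubIn.exists_cof_eq {c : Cardinal.{0}} (hc : c.IsRegular) {E : Set Ordinal.{0}}
    (hE : IsClubIn E c.ord) {s : Cardinal.{0}} (hs : s.IsRegular) (hsc : s < c) {x : Ordinal.{0}}
    (hx : x < c.ord) : ∃ δ ∈ E, x < δ ∧ δ.cof = s := by
  have hlim := isSuccLimit_ord hs.aleph0_le
  obtain ⟨h, h1, h2⟩ := exists_increasing (lam := c.ord) (ρ := s.ord)
    (fun ξ hξ => by rw [hc.cof_ord]; exact (lt_ord.1 hξ).trans hsc)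
    (U := E ∩ Ioi x) (fun y hy => by
      obtain ⟨z, hz, hlt, hzl⟩ := hE.exists_gt hc (max_lt hx hy)
      exact ⟨z, ⟨hz, (le_max_left _ _).trans_lt hlt⟩, (le_max_right _ _).trans_lt hlt, hzl⟩)
  have hmono : StrictMono fun i : Iio s.ord => h i := fun a b hab => h2 _ _ hab b.2
  have hcof := cof_iSup_Iio hmono hlim.isSuccPrelimit
  have hset : range (fun i : Iio s.ord => h i) = h '' Iio s.ord := by
    rw [image_eq_range]
  rw [iSup, hset, hs.cof_ord] at hcof
  obtain ⟨b, hb, hb'⟩ := (sizeLE_Iio_ord s).exists_bound_image (o := c.ord)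
    (by rwa [hc.cof_ord]) (f := h) fun ξ hξ => (h1 ξ hξ).2
  have hbd : BddAbove (h '' Iio s.ord) := ⟨b, by rintro _ ⟨ξ, hξ, rfl⟩; exact (hb' ξ hξ).le⟩
  have h0 : h 0 ∈ h '' Iio s.ord := ⟨0, hlim.bot_lt, rfl⟩
  refine ⟨sSup (h '' Iio s.ord), hE.2.1.sSup_mem ?_ ⟨_, h0⟩ (z := b) ?_ hb, ?_, hcof⟩
  · rintro _ ⟨ξ, hξ, rfl⟩; exact (h1 ξ hξ).1.1
  · rintro _ ⟨ξ, hξ, rfl⟩; exact (hb' ξ hξ).le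
  · exact lt_of_lt_of_le (h1 0 hlim.bot_lt).1.2 (le_csSup hbd h0)

/-- Iterating an operation on club sets, taking intersections along the way. -/
theorem exists_club_iteration {c : Cardinal.{0}} (hc : c.IsRegular) (hu : ℵ₀ < c)
    (N : Set Ordinal.{0} → Set Ordinal.{0})
    (hN : ∀ E, IsClubIn E c.ord → IsClubIn (N E) c.ord) :
    ∃ E : Ordinal.{0} → Set Ordinal.{0}, (∀ k < c.ord, IsClubIn (E k) c.ord) ∧
      (∀ k l, k ≤ l → E l ⊆ E k) ∧ ∀ k l, k < l → E l ⊆ N (E k) := by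
  obtain ⟨E, hE⟩ := exists_rec (X := Set Ordinal.{0})
    (fun k G b => b = {y | y < c.ord ∧ ∀ l ∈ Iio k, y ∈ N (G l)}) (fun k G => ⟨_, rfl⟩)
    (fun k G G' b hG hb => by
      rw [hb]
      ext y
      exact and_congr_right fun _ => forall₂_congr fun l hl => by rw [hG l hl])
  refine ⟨E, fun k => ?_, fun k l hkl => ?_, fun k l hkl => ?_⟩
  · induction k using WellFoundedLT.induction with
    | ind k ih =>
      intro hk
      rw [hE]
      exact isClubIn_biInter hc hu (sizeLE_Iio k) (lt_ord.1 hk)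
        fun l hl => hN _ (ih l hl (lt_trans hl hk))
  · rw [hE k, hE l]
    exact fun y hy => ⟨hy.1, fun i hi => hy.2 i (lt_of_lt_of_le hi hkl)⟩
  · rw [hE l]
    exact fun y hy => hy.2 k hkl

/-! ### Guessing clubs along ladders -/

/-- `Reach E m δ y`: starting from `δ`, the point `y` is obtained by repeatedly replacing an ordinal
of cofinality at most `m` by the projection to `E` of a point of its ladder. -/
inductive Reach (E : Set Ordinal.{0}) (m : Cardinal.{0}) (δ : Ordinal.{0}) : Ordinal.{0} → Prop
  | refl : Reach E m δ δ
  | step {y z : Ordinal.{0}} : Reach E m δ y → y.cof ≤ m → z ∈ ladder y →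
      Reach E m δ (sSup (E ∩ Iic z))

theorem Reach.trans {E : Set Ordinal.{0}} {m : Cardinal.{0}} {a b d : Ordinal.{0}}
    (h : Reach E m a b) (h' : Reach E m b d) : Reach E m a d := by
  induction h' with
  | refl => exact h
  | step _ h2 h3 ih => exact ih.step h2 h3

theorem sSup_inter_Iic_le (E : Set Ordinal.{0}) (z : Ordinal.{0}) : sSup (E ∩ Iic z) ≤ z :=
  csSup_le' fun _ h => h.2

theorem Reach.exists_stable {lam ρ : Ordinal.{0}} (hρ : 0 < ρ) {E : Ordinal.{0} → Set Ordinal.{0}}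
    (hE : ∀ k < ρ, ClosedIn (E k) lam) (hanti : ∀ k l, k ≤ l → E l ⊆ E k) {m : Cardinal.{0}}
    {w : Ordinal.{0}} (hw : w ∈ E ρ) (hwm : m < w.cof) (y' : Ordinal.{0}) (hwy : w < y')
    (hy'm : y'.cof ≤ m) (hy' : y' < lam) :
    ∃ k0 < ρ, ∃ y, w ≤ y ∧ y < y' ∧ m < y.cof ∧
      ∀ k, k0 ≤ k → k < ρ → y ∈ E k ∧ Reach (E k) m y' y := by
  induction y' using WellFoundedLT.induction with
  | ind y' ih =>
    obtain ⟨z, hz, hwz⟩ := exists_mem_ladder hwy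
    have hzy : z < y' := ladder_subset _ hz
    have hbd : ∀ k, BddAbove (E k ∩ Iic z) := fun k => ⟨z, fun _ h => h.2⟩
    have hmem : ∀ k ≤ ρ, w ∈ E k ∩ Iic z := fun k hk => ⟨hanti k ρ hk hw, hwz⟩
    obtain ⟨k0, hk0, hst⟩ := _root_.exists_stable (fun k => sSup (E k ∩ Iic z)) hρ fun k l hkl hl =>
      csSup_le_csSup (hbd k) ⟨w, hmem l hl.le⟩ (inter_subset_inter_left _ (hanti k l hkl))
    set y1 := sSup (E k0 ∩ Iic z) with hy1
    have hwy1 : w ≤ y1 := le_csSup (hbd k0) (hmem k0 hk0.le)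
    have hy1y : y1 < y' := (sSup_inter_Iic_le _ _).trans_lt hzy
    have hyE : ∀ k, k0 ≤ k → k < ρ → y1 ∈ E k ∧ Reach (E k) m y' y1 := by
      intro k hk hkρ
      rw [← hst k hk hkρ]
      exact ⟨(hE k hkρ).sSup_mem inter_subset_left ⟨w, hmem k hkρ.le⟩ (fun _ h => h.2)
        (hzy.trans hy'), Reach.refl.step hy'm hz⟩
    by_cases hcof : m < y1.cof
    · exact ⟨k0, hk0, y1, hwy1, hy1y, hcof, hyE⟩
    · have hlt : w < y1 := lt_of_le_of_ne hwy1 fun h => hcof (h ▸ hwm)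
      obtain ⟨k1, hk1, y, h1, h2, h3, h4⟩ := ih y1 hy1y hlt (not_lt.1 hcof) (hy1y.trans hy')
      refine ⟨max k0 k1, max_lt hk0 hk1, y, h1, h2.trans hy1y, h3, fun k hk hkρ => ?_⟩
      obtain ⟨h5, h6⟩ := h4 k ((le_max_right _ _).trans hk) hkρ
      exact ⟨h5, (hyE k ((le_max_left _ _).trans hk) hkρ).2.trans h6⟩

theorem exists_club_guess {c : Cardinal.{0}} (hc : c.IsRegular) (hu : ℵ₀ < c) {s : Cardinal.{0}}
    (hs : s.IsRegular) (hsc : Order.succ s < c) {I : Set Ordinal.{0}} {d : Cardinal.{0}}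
    (hI : SizeLE I d) (hds : d ≤ s) (m : Ordinal.{0} → Cardinal.{0})
    (hm : ∀ i ∈ I, s ≤ m i ∧ Order.succ (m i) < c) :
    ∃ E, IsClubIn E c.ord ∧ ∀ D, IsClubIn D c.ord → ∃ δ ∈ D, δ.cof = s ∧ ∀ i ∈ I, ∀ x < δ,
      ∃ y, x < y ∧ y < δ ∧ y ∈ D ∧ m i < y.cof ∧ Reach E (m i) δ y := by
  by_contra! hcon
  choose! N hN hN' using hcon
  obtain ⟨E, hE, hanti, hEN⟩ := exists_club_iteration hc hu N hN
  have hρr : (Order.succ s).IsRegular := isRegular_succ hs.aleph0_le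
  set ρ := (Order.succ s).ord with hρ
  have hρc : ρ < c.ord := ord_lt_ord.2 hsc
  have hρcof : ρ.cof = Order.succ s := hρr.cof_ord
  have hsρ : s < ρ.cof := by rw [hρcof]; exact Order.lt_succ s
  have hρ0 : 0 < ρ := pos_of_aleph0_le_cof (by rw [hρcof]; exact hρr.aleph0_le)
  have hscc : s < c := (Order.lt_succ s).trans hsc
  have hbase : ∀ x < c.ord, ∃ b < c.ord, ∀ i ∈ I, ∃ w < b, w ∈ E ρ ∧ x < w ∧ m i < w.cof := by
    intro x hx
    refine hI.exists_bound_choice (by rw [hc.cof_ord]; exact hds.trans_lt hscc) fun i hi => ?_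
    have hr : (Order.succ (m i)).IsRegular := isRegular_succ (hs.aleph0_le.trans (hm i hi).1)
    obtain ⟨w, hw, hxw, hwc⟩ := (hE ρ hρc).exists_cof_eq hc hr (hm i hi).2 hx
    exact ⟨w, (hE ρ hρc).1 hw, hw, hxw, by rw [hwc]; exact Order.lt_succ _⟩
  choose! F hF1 hF2 using hbase
  obtain ⟨δ, ⟨⟨hδl, hδF⟩, hδE⟩, -, hδs⟩ :=
    ((isClubIn_closure_points hc hu hF1).inter hc hu (hE ρ hρc)).exists_cof_eq hc hs hscc
      (pos_of_aleph0_le_cof (o := c.ord) (by rw [hc.cof_ord]; exact hc.aleph0_le))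
  obtain ⟨k, hk, hkb⟩ := hI.exists_bound_choice (hds.trans_lt hsρ)
    (P := fun i b => ∀ x ∈ ladder δ, ∃ k0 < b, ∃ y, x < y ∧ y < δ ∧ m i < y.cof ∧
      ∀ k, k0 ≤ k → k < ρ → y ∈ E k ∧ Reach (E k) (m i) δ y) (fun i hi => by
    refine (sizeLE_ladder δ).exists_bound_choice (by rwa [hδs]) fun x hx => ?_
    have hxδ : x < δ := ladder_subset _ hx
    obtain ⟨w, hw, hwE, hxw, hwm⟩ := hF2 x (hxδ.trans hδl) i hi
    obtain ⟨k0, hk0, y, h1, h2, h3⟩ := Reach.exists_stable hρ0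
      (fun k hk => (hE k (hk.trans hρc)).2.1) hanti hwE hwm δ (hw.trans (hδF x hxδ))
      (hδs.trans_le (hm i hi).1) hδl
    exact ⟨k0, hk0, y, hxw.trans_le h1, h2, h3⟩)
  have hk1 : k + 1 < ρ := succ_lt_of_aleph0_le_cof (by rw [hρcof]; exact hρr.aleph0_le) hk
  have hsub := hEN k (k + 1) (Order.lt_add_one_iff.2 le_rfl)
  obtain ⟨i, hi, x, hx, hno⟩ := hN' (E k) (hE k (hk.trans hρc)) δ
    (hsub (hanti _ ρ hk1.le hδE)) hδs
  obtain ⟨b, hb, hbx⟩ := hkb i hi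
  obtain ⟨z, hz, hxz⟩ := exists_mem_ladder hx
  obtain ⟨k0, hk0, y, h1, h2, h3, h4⟩ := hbx z hz
  exact hno y (hxz.trans_lt h1) h2
    (hsub (h4 (k + 1) ((hk0.trans hb).le.trans (Order.lt_add_one_iff.2 le_rfl).le) hk1).1) h3
    (h4 k (hk0.trans hb).le hk).2

/-! ### Walks along enriched ladders -/

theorem Reach.le {E : Set Ordinal.{0}} {m : Cardinal.{0}} {δ y : Ordinal.{0}}
    (h : Reach E m δ y) : y ≤ δ := by
  induction h with
  | refl => exact le_rfl
  | step _ _ h3 ih => exact (sSup_inter_Iic_le _ _).trans ((ladder_subset _ h3).le.trans ih)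

/-- The limit points of `Z` that are not above all points of `Z`. -/
def limPts (Z : Set Ordinal.{0}) : Set Ordinal.{0} :=
  {δ | (∃ y ∈ Z, δ ≤ y) ∧ ∀ x < δ, ∃ z ∈ Z, x < z ∧ z < δ}

theorem limPts_subset (Z : Set Ordinal.{0}) : limPts Z ⊆ (fun y => sSup (Z ∩ Iio y)) '' Z := by
  rintro δ ⟨⟨y0, hy0, hδy0⟩, hδ⟩
  have hne : (Z ∩ Ici δ).Nonempty := ⟨y0, hy0, hδy0⟩
  obtain ⟨hy, hδy⟩ := csInf_mem hne
  have hmin : ∀ z ∈ Z, δ ≤ z → sInf (Z ∩ Ici δ) ≤ z := fun z hz hz' => csInf_le' ⟨hz, hz'⟩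
  refine ⟨sInf (Z ∩ Ici δ), hy, le_antisymm (csSup_le' fun z hz => ?_)
    (le_of_forall_lt fun x hx => ?_)⟩
  · by_contra! hlt
    exact (hmin z hz.1 hlt.le).not_gt hz.2
  · obtain ⟨z, hz, hxz, hzδ⟩ := hδ x hx
    exact hxz.trans_le (le_csSup ⟨_, fun _ h => h.2.le⟩ ⟨hz, hzδ.trans_le hδy⟩)

theorem limPts_mono {Z Z' : Set Ordinal.{0}} (h : Z ⊆ Z') : limPts Z ⊆ limPts Z' :=
  fun _ ⟨⟨y, hy, hδy⟩, hδ⟩ => ⟨⟨y, h hy, hδy⟩, fun x hx =>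
    let ⟨z, hz, hz'⟩ := hδ x hx
    ⟨z, h hz, hz'⟩⟩

/-- One round of closing `Z` under limits and projections of ladder points. -/
def enrich (E : Set Ordinal.{0}) (m : Cardinal.{0}) (Z : Set Ordinal.{0}) : Set Ordinal.{0} :=
  (Z ∪ limPts Z) ∪
    ⋃ y ∈ {y ∈ Z | y.cof ≤ m}, (fun z => sSup (E ∩ Iic z)) '' ladder y

/-- The stages in the construction of the enriched ladder of `β`. -/
def enrichIter (E : Set Ordinal.{0}) (m : Cardinal.{0}) (β : Ordinal.{0}) : ℕ → Set Ordinal.{0}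
  | 0 => {β} ∪ ladder β
  | n + 1 => enrich E m (enrichIter E m β n)

/-- The enriched ladder of `β`, with its top point `β` included. -/
def topLadder (E : Set Ordinal.{0}) (m : Cardinal.{0}) (β : Ordinal.{0}) : Set Ordinal.{0} :=
  ⋃ n, enrichIter E m β n

/-- The enriched ladder of `β`. -/
def eLadder (E : Set Ordinal.{0}) (m : Cardinal.{0}) (β : Ordinal.{0}) : Set Ordinal.{0} :=
  topLadder E m β ∩ Iio β

section

variable {E : Set Ordinal.{0}} {m : Cardinal.{0}} {β : Ordinal.{0}}

theorem subset_enrich (Z : Set Ordinal.{0}) : Z ⊆ enrich E m Z :=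
  fun _ h => Or.inl (Or.inl h)

theorem enrich_mono {m' : Cardinal.{0}} (h : m ≤ m') {Z Z' : Set Ordinal.{0}} (hZ : Z ⊆ Z') :
    enrich E m Z ⊆ enrich E m' Z' := by
  refine union_subset_union (union_subset_union hZ (limPts_mono hZ)) (biUnion_subset_biUnion_left ?_)
  exact fun y hy => ⟨hZ hy.1, hy.2.trans h⟩

theorem enrichIter_mono_nat : Monotone (enrichIter E m β) :=
  monotone_nat_of_le_succ fun _ => subset_enrich _

theorem sizeLE_topLadder {t : Cardinal.{0}} (ht : ℵ₀ ≤ t) (hm : m ≤ t) (hβ : β.cof ≤ t) :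
    SizeLE (topLadder E m β) t := by
  refine sizeLE_iUnion_nat ht fun n => ?_
  induction n with
  | zero => exact sizeLE_union ht (sizeLE_singleton ht) ((sizeLE_ladder β).mono subset_rfl hβ)
  | succ n ih =>
    refine sizeLE_union ht (sizeLE_union ht ih ((ih.image _).mono (limPts_subset _) le_rfl)) (sizeLE_biUnion ht
      (ih.mono (sep_subset _ _) le_rfl) fun y hy => ?_)
    exact ((sizeLE_ladder y).mono subset_rfl (hy.2.trans hm)).image _

theorem sizeLE_eLadder {t : Cardinal.{0}} (ht : ℵ₀ ≤ t) (hm : m ≤ t) (hβ : β.cof ≤ t) :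
    SizeLE (eLadder E m β) t :=
  (sizeLE_topLadder ht hm hβ).mono inter_subset_left le_rfl

theorem exists_mem_eLadder {x : Ordinal.{0}} (h : x < β) : ∃ y ∈ eLadder E m β, x ≤ y := by
  obtain ⟨y, hy, hxy⟩ := exists_mem_ladder h
  exact ⟨y, ⟨mem_iUnion.2 ⟨0, Or.inr hy⟩, ladder_subset _ hy⟩, hxy⟩

theorem Reach.mem_topLadder {δ y : Ordinal.{0}} (h : Reach E m δ y) (hδ : δ ∈ topLadder E m β) :
    y ∈ topLadder E m β := by
  induction h with
  | refl => exact hδ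
  | @step y z _ h2 h3 ih =>
    obtain ⟨n, hn⟩ := mem_iUnion.1 ih
    exact mem_iUnion.2 ⟨n + 1, Or.inr (mem_biUnion (x := y) ⟨hn, h2⟩ ⟨z, h3, rfl⟩)⟩

theorem Reach.mem_eLadder {δ y : Ordinal.{0}} (h : Reach E m δ y) (hδ : δ ∈ eLadder E m β) :
    y ∈ eLadder E m β :=
  ⟨h.mem_topLadder hδ.1, h.le.trans_lt hδ.2⟩

theorem mem_eLadder_of_unbounded {δ : Ordinal.{0}} (hδ : ℵ₀ < δ.cof) (hδβ : δ < β)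
    (hun : ∀ x < δ, ∃ y ∈ eLadder E m β, x < y ∧ y < δ) : δ ∈ eLadder E m β := by
  refine ⟨?_, hδβ⟩
  have hstage : ∃ n, ∀ x < δ, ∃ z ∈ enrichIter E m β n, x < z ∧ z < δ := by
    by_contra! hcon
    choose b hb hb' using hcon
    have hcount : #(range b) < Cardinal.lift.{1, 0} δ.cof := by
      refine lt_of_le_of_lt (b := ℵ₀) (mk_le_aleph0_iff.2 (countable_range b)) ?_
      rw [← Cardinal.lift_aleph0.{1, 0}]
      exact Cardinal.lift_lt.2 hδ
    obtain ⟨x, hx, hx'⟩ := exists_bound_of_lt_cof hcount (by rintro _ ⟨n, rfl⟩; exact hb n)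
    obtain ⟨z, hz, hxz, hzδ⟩ := hun x hx
    obtain ⟨n, hn⟩ := mem_iUnion.1 hz.1
    exact (hb' n z hn ((hx' _ ⟨n, rfl⟩).trans hxz)).not_gt hzδ
  obtain ⟨n1, hn1⟩ := hstage
  refine mem_iUnion.2 ⟨n1 + 1, Or.inl (Or.inr ⟨⟨β, ?_, hδβ.le⟩, hn1⟩)⟩
  exact enrichIter_mono_nat (Nat.zero_le n1) (Or.inl rfl)

end

theorem eLadder_mono {E : Set Ordinal.{0}} {m m' : Cardinal.{0}} (h : m ≤ m') (β : Ordinal.{0}) :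
    eLadder E m β ⊆ eLadder E m' β := by
  refine inter_subset_inter_left _ (iUnion_mono fun n => ?_)
  induction n with
  | zero => exact subset_rfl
  | succ n ih =>
    exact enrich_mono h ih

/-- One step of the walk from `β` down to `α`. -/
def walkStep (E : Set Ordinal.{0}) (m : Cardinal.{0}) (α β : Ordinal.{0}) : Ordinal.{0} :=
  sInf (eLadder E m β ∩ Ici α)

theorem walkStep_mem {E : Set Ordinal.{0}} {m : Cardinal.{0}} {α β : Ordinal.{0}} (h : α < β) :
    walkStep E m α β ∈ eLadder E m β ∩ Ici α := by
  obtain ⟨y, hy, hxy⟩ := exists_mem_eLadder (E := E) (m := m) h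
  exact csInf_mem ⟨y, hy, hxy⟩

/-- The first point of large cofinality on the walk from `β` down to `α`. -/
def hit (E : Set Ordinal.{0}) (m : Cardinal.{0}) (α β : Ordinal.{0}) : Ordinal.{0} :=
  open Classical in
  if _h : α < β ∧ β.cof ≤ m then hit E m α (walkStep E m α β) else β
termination_by β
decreasing_by exact (walkStep_mem _h.1).1.2

/-- The supremum below `α` of the ladders used before the walk reaches `hit`. -/
def low (E : Set Ordinal.{0}) (m : Cardinal.{0}) (α β : Ordinal.{0}) : Ordinal.{0} :=
  open Classical in
  if _h : α < β ∧ β.cof ≤ m then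
    max (sSup (eLadder E m β ∩ Iio α)) (low E m α (walkStep E m α β)) else 0
termination_by β
decreasing_by exact (walkStep_mem _h.1).1.2

theorem hit_eq_self {E : Set Ordinal.{0}} {m : Cardinal.{0}} {α β : Ordinal.{0}}
    (h : m < β.cof) : hit E m α β = β := by
  rw [hit, dif_neg fun h' => h'.2.not_gt h]

theorem low_eq_zero {E : Set Ordinal.{0}} {m : Cardinal.{0}} {α β : Ordinal.{0}}
    (h : m < β.cof) : low E m α β = 0 := by
  rw [low, dif_neg fun h' => h'.2.not_gt h]

theorem hit_eq_walkStep {E : Set Ordinal.{0}} {m : Cardinal.{0}} {α β : Ordinal.{0}} (h : α < β)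
    (hm : β.cof ≤ m) : hit E m α β = hit E m α (walkStep E m α β) := by
  rw [hit, dif_pos ⟨h, hm⟩]

theorem low_eq_walkStep {E : Set Ordinal.{0}} {m : Cardinal.{0}} {α β : Ordinal.{0}} (h : α < β)
    (hm : β.cof ≤ m) : low E m α β =
      max (sSup (eLadder E m β ∩ Iio α)) (low E m α (walkStep E m α β)) := by
  rw [low, dif_pos ⟨h, hm⟩]

theorem walkStep_eq {E : Set Ordinal.{0}} {m : Cardinal.{0}} {α β y : Ordinal.{0}}
    (hy : y ∈ eLadder E m β) (hαy : α ≤ y) (h : ∀ x ∈ eLadder E m β, x < y → x < α) :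
    walkStep E m α β = y := by
  refine le_antisymm (csInf_le' ⟨hy, hαy⟩) (le_csInf ⟨y, hy, hαy⟩ fun x hx => ?_)
  by_contra! hlt
  exact (h x hx.1 hlt).not_ge hx.2

/-- The conclusion of the walk analysis: near `y`, walks from `ζ` hit `y`. -/
def GoodAt (E : Set Ordinal.{0}) (m : Cardinal.{0}) (δ ζ y γ : Ordinal.{0}) : Prop :=
  ∀ α, γ < α → α < y → hit E m α ζ = y ∧ low E m α ζ ≤ γ ∧
    ∀ z, Reach E m δ z → z < α → z ≤ low E m α ζ

theorem GoodAt.mono {E : Set Ordinal.{0}} {m : Cardinal.{0}} {δ ζ y γ γ' : Ordinal.{0}}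
    (h : GoodAt E m δ ζ y γ) (hγ : γ ≤ γ') : GoodAt E m δ ζ y γ' := fun α h1 h2 =>
  let ⟨h3, h4, h5⟩ := h α (hγ.trans_lt h1) h2
  ⟨h3, h4.trans hγ, h5⟩

theorem exists_goodAt {E : Set Ordinal.{0}} {m : Ordinal.{0} → Cardinal.{0}} {K lam : Ordinal.{0}}
    (hK : 0 < K) (hm : ∀ i j, i ≤ j → j < K → m i ≤ m j) (hm0 : ∀ i < K, ℵ₀ ≤ m i)
    (hcof : ∀ ζ < lam, ∃ i < K, ζ.cof ≤ m i) {δ : Ordinal.{0}} (hδ : ℵ₀ < δ.cof) (ζ : Ordinal.{0})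
    (hδζ : δ < ζ) (hζ : ζ < lam) :
    ∃ i0 < K, ∀ i, i0 ≤ i → i < K → ∃ γ < δ, ∀ y, γ < y → y < δ → m i < y.cof →
      Reach E (m i) δ y → ∃ γ' < y, GoodAt E (m i) δ ζ y γ' := by
  induction ζ using WellFoundedLT.induction with
  | ind ζ ih =>
    have hδ0 : 0 < δ := pos_of_aleph0_le_cof hδ.le
    obtain ⟨i1, hi1, hζm⟩ := hcof ζ hζ
    obtain ⟨i2, hi2, hst⟩ := exists_stable (fun i => walkStep E (m i) δ ζ) hK fun i j hij hj =>
      csInf_le_csInf' ⟨_, walkStep_mem hδζ⟩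
        (inter_subset_inter_left _ (eLadder_mono (hm i j hij hj) ζ))
    have hmem : ∀ i, i2 ≤ i → i < K → walkStep E (m i2) δ ζ ∈ eLadder E (m i) ζ :=
      fun i h h' => hst i h h' ▸ (walkStep_mem hδζ).1
    have hle : δ ≤ walkStep E (m i2) δ ζ := (walkStep_mem hδζ).2
    have hlt : walkStep E (m i2) δ ζ < ζ := (walkStep_mem hδζ).1.2
    have hmin : ∀ i, i2 ≤ i → i < K → ∀ x ∈ eLadder E (m i) ζ, δ ≤ x →
        walkStep E (m i2) δ ζ ≤ x := fun i h h' x hx hδx => hst i h h' ▸ csInf_le' ⟨hx, hδx⟩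
    generalize walkStep E (m i2) δ ζ = ζ' at hmem hle hlt hmin
    have hζi : ∀ i, max i1 i2 ≤ i → i < K → ζ.cof ≤ m i := fun i h h' =>
      hζm.trans (hm _ _ ((le_max_left _ _).trans h) h')
    rcases hle.eq_or_lt with rfl | hlt'
    · refine ⟨max i1 i2, max_lt hi1 hi2, fun i hi hiK => ⟨0, hδ0, fun y _ hy hym hr => ?_⟩⟩
      have hmi := hmem i ((le_max_right _ _).trans hi) hiK
      have hye := hr.mem_eLadder hmi
      obtain ⟨γ', hγ', hb⟩ := ((sizeLE_eLadder (E := E) (hm0 i hiK) le_rfl (hζi i hi hiK)).mono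
        (inter_subset_left (t := Iio y)) le_rfl).exists_bound hym fun x hx => hx.2
      refine ⟨γ', hγ', fun α hα hαy => ?_⟩
      have hαζ : α < ζ := hαy.trans (hy.trans hδζ)
      have hstep : walkStep E (m i) α ζ = y :=
        walkStep_eq hye hαy.le fun x hx hxy => (hb x ⟨hx, hxy⟩).trans hα
      have hl : low E (m i) α ζ = sSup (eLadder E (m i) ζ ∩ Iio α) := by
        rw [low_eq_walkStep hαζ (hζi i hi hiK), hstep, low_eq_zero hym]
        simp
      refine ⟨?_, ?_, fun z hz hzα => ?_⟩
      · rw [hit_eq_walkStep hαζ (hζi i hi hiK), hstep, hit_eq_self hym]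
      · rw [hl]
        exact csSup_le' fun x hx => (hb x ⟨hx.1, lt_trans hx.2 hαy⟩).le
      · rw [hl]
        exact le_csSup ⟨α, fun _ h => h.2.le⟩ ⟨hz.mem_eLadder hmi, hzα⟩
    · obtain ⟨i3, hi3, hih⟩ := ih ζ' hlt hlt' (hlt.trans hζ)
      refine ⟨max (max i1 i2) i3, max_lt (max_lt hi1 hi2) hi3, fun i hi hiK => ?_⟩
      have hi12 := (le_max_left _ _).trans hi
      have hi2' := (le_max_right _ _).trans hi12
      obtain ⟨γ, hγ, hγy⟩ := hih i ((le_max_right _ _).trans hi) hiK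
      have hδn : δ ∉ eLadder E (m i) ζ := fun h => (hmin i hi2' hiK δ h le_rfl).not_gt hlt'
      obtain ⟨γ1, hγ1, hb⟩ : ∃ γ1 < δ, ∀ x ∈ eLadder E (m i) ζ, x < δ → x ≤ γ1 := by
        by_contra! hcon
        refine hδn (mem_eLadder_of_unbounded hδ hδζ fun x hx => ?_)
        obtain ⟨z, hz, h1, h2⟩ := hcon x hx
        exact ⟨z, hz, h2, h1⟩
      refine ⟨max γ γ1, max_lt hγ hγ1, fun y hy hyδ hym hr => ?_⟩
      obtain ⟨γ', hγ', hg⟩ := hγy y ((le_max_left _ _).trans_lt hy) hyδ hym hr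
      refine ⟨max γ' γ1, max_lt hγ' ((le_max_right _ _).trans_lt hy), fun α hα hαy => ?_⟩
      obtain ⟨h1, h2, h3⟩ := hg α ((le_max_left _ _).trans_lt hα) hαy
      have hγα : γ1 < α := (le_max_right _ _).trans_lt hα
      have hαδ := hαy.trans hyδ
      have hαζ : α < ζ := hαδ.trans hδζ
      have hstep : walkStep E (m i) α ζ = ζ' := by
        refine walkStep_eq (hmem i hi2' hiK) (hαδ.trans hlt').le fun x hx hxζ => ?_
        by_contra! hαx
        refine (hmin i hi2' hiK x hx ?_).not_gt hxζ
        by_contra! hxδ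
        exact (hγα.trans_le hαx).not_ge (hb x hx hxδ)
      refine ⟨?_, ?_, fun z hz hzα => ?_⟩
      · rw [hit_eq_walkStep hαζ (hζi i hi12 hiK), hstep, h1]
      · rw [low_eq_walkStep hαζ (hζi i hi12 hiK), hstep]
        refine max_le (csSup_le' fun x hx => ?_) (h2.trans (le_max_left _ _))
        exact (hb x hx.1 (lt_trans hx.2 hαδ)).trans (le_max_right _ _)
      · rw [low_eq_walkStep hαζ (hζi i hi12 hiK), hstep]
        exact (h3 z hz hzα).trans (le_max_right _ _)

/-! ### Scales and the index colouring -/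

/-- A weak scale: `f` is increasing and cofinal in the product of the `g i` modulo bounded sets, and
the cofinalities of the `g i` increase to `μ`. -/
structure PScale (K lam : Ordinal.{0}) (κ μ : Cardinal.{0}) (g : Ordinal.{0} → Ordinal.{0})
    (f : Ordinal.{0} → Ordinal.{0} → Ordinal.{0}) : Prop where
  gap : ∀ i < K, ∃ t, κ ≤ t ∧ t < (g i).cof ∧ ∀ j < i, (g j).cof ≤ t
  cof_lt : ∀ i < K, (g i).cof < μ
  cofinal : ∀ t < μ, ∃ i < K, t < (g i).cof
  f_lt : ∀ α < lam, ∀ i < K, f α i < g i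
  f_mono : ∀ α β, α ≤ β → β < lam → ∃ i0 < K, ∀ i, i0 ≤ i → i < K → f α i ≤ f β i
  f_cofinal : ∀ d : Ordinal.{0} → Ordinal.{0}, (∀ i < K, d i < g i) →
    ∃ α < lam, ∃ i0 < K, ∀ i, i0 ≤ i → i < K → d i < f α i

theorem CardLT.exists_sizeLE {t : Set Ordinal.{0}} {κ : Cardinal.{0}} (h : CardLT t κ) :
    ∃ d < κ, SizeLE t d := by
  obtain ⟨d, hd, hd'⟩ := Cardinal.lt_lift_iff.1 h
  exact ⟨d, hd, hd'.ge⟩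

/-- A function attaining each value below `κ.ord` cofinally often. -/
theorem exists_cofinally_onto {κ : Cardinal.{0}} (hκ : ℵ₀ ≤ κ) :
    ∃ hh : Ordinal.{0} → Ordinal.{0}, ∀ i < κ.ord, ∀ b < κ.ord, ∃ j, b ≤ j ∧ j < κ.ord ∧
      hh j = i := by
  have hcard : #(Iio κ.ord) = Cardinal.lift.{1, 0} κ := by rw [Cardinal.mk_Iio_ordinal, card_ord]
  have heq : #(Iio κ.ord × Iio κ.ord) = #(Iio κ.ord) := by
    rw [← mul_def]
    exact mul_eq_self (by rw [hcard]; simpa using hκ)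
  obtain ⟨e⟩ := Cardinal.eq.1 heq
  refine ⟨fun j => if h : j < κ.ord then (e.symm ⟨j, h⟩).1 else 0, fun i hi b hb => ?_⟩
  by_contra! hcon
  let p : Iio κ.ord := ⟨i, hi⟩
  have hinj : Function.Injective fun x : Iio κ.ord => (e (p, x) : Ordinal.{0}) := by
    intro x y hxy
    have := e.injective (Subtype.ext hxy)
    exact (Prod.ext_iff.1 this).2
  have hsub : ∀ x : Iio κ.ord, (e (p, x) : Ordinal.{0}) < b := by
    intro x
    by_contra! hle
    have hlt : (e (p, x) : Ordinal.{0}) < κ.ord := (e (p, x)).2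
    refine hcon _ hle hlt ?_
    rw [dif_pos hlt]
    change ((e.symm (e (p, x))).1 : Ordinal.{0}) = i
    rw [Equiv.symm_apply_apply]
  have h1 : #(Iio κ.ord) ≤ #(Iio b) :=
    mk_le_of_injective (f := fun x => (⟨_, hsub x⟩ : Iio b)) fun x y hxy => by
      have h := congrArg Subtype.val hxy
      exact hinj h
  rw [hcard, Cardinal.mk_Iio_ordinal, Cardinal.lift_le] at h1
  exact h1.not_gt (lt_ord.1 hb)

/-- The last coordinate at which `f ζ` does not exceed `f α`. -/
def lastLE (K : Ordinal.{0}) (f : Ordinal.{0} → Ordinal.{0} → Ordinal.{0}) (α ζ : Ordinal.{0}) :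
    Ordinal.{0} :=
  sSup {i | i < K ∧ f ζ i ≤ f α i}

theorem lastLE_eq {K : Ordinal.{0}} {f : Ordinal.{0} → Ordinal.{0} → Ordinal.{0}}
    {α ζ i : Ordinal.{0}} (hi : i < K) (h : f ζ i ≤ f α i)
    (h' : ∀ j, i < j → j < K → f α j < f ζ j) : lastLE K f α ζ = i := by
  refine le_antisymm (csSup_le' fun j hj => ?_) (le_csSup ⟨K, fun _ hj => hj.1.le⟩ ⟨hi, h⟩)
  by_contra! hlt
  exact (h' j hlt hj.1).not_ge hj.2

theorem PScale.exists_bound_of_small {K lam : Ordinal.{0}} {κ μ : Cardinal.{0}}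
    {g : Ordinal.{0} → Ordinal.{0}} {f : Ordinal.{0} → Ordinal.{0} → Ordinal.{0}}
    (hf : PScale K lam κ μ g f) (hK : K.cof = κ) {u : Set Ordinal.{0}} (hu : CardLT u κ)
    {β : Ordinal.{0}} (hβ : ∀ ζ ∈ u, β ≤ ζ ∧ ζ < lam) :
    ∃ i0 < K, ∀ i, i0 ≤ i → i < K → ∀ ζ ∈ u, f β i ≤ f ζ i := by
  obtain ⟨d, hd, hud⟩ := hu.exists_sizeLE
  obtain ⟨i0, hi0, h⟩ := hud.exists_bound_choice (hd.trans_eq hK.symm) fun ζ hζ =>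
    hf.f_mono β ζ (hβ ζ hζ).1 (hβ ζ hζ).2
  refine ⟨i0, hi0, fun i hi hiK ζ hζ => ?_⟩
  obtain ⟨j, hj, hj'⟩ := h ζ hζ
  exact hj' i (hj.le.trans hi) hiK

theorem PScale.eventually_large {K lam : Ordinal.{0}} {κ μ : Cardinal.{0}} (hκ : ℵ₀ ≤ κ)
    {g : Ordinal.{0} → Ordinal.{0}} {f : Ordinal.{0} → Ordinal.{0} → Ordinal.{0}}
    (hf : PScale K lam κ μ g f) (hK : K.cof = κ) {A : Set Ordinal.{0}}
    {t : Ordinal.{0} → Set Ordinal.{0}} (ht : ∀ a ∈ A, CardLT (t a) κ)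
    (hA : ∀ b < lam, ∃ a ∈ A, a < lam ∧ t a ⊆ Ioo b lam) {γ : Ordinal.{0}} (hγ : γ < lam) :
    ∃ i0 < K, ∀ i, i0 ≤ i → i < K → ∀ η < g i,
      ∃ a ∈ A, a < lam ∧ t a ⊆ Ioo γ lam ∧ ∀ α ∈ t a, η < f α i := by
  by_contra! hcon
  let Bad : Ordinal.{0} → Ordinal.{0} → Prop := fun i η =>
    η < g i ∧ ∀ a ∈ A, a < lam → t a ⊆ Ioo γ lam → ∃ α ∈ t a, f α i ≤ η
  have hd : ∀ i, ∃ η, (i < K → η < g i) ∧ ((∃ η', Bad i η') → Bad i η) := by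
    intro i
    by_cases h : ∃ η', Bad i η'
    · obtain ⟨η, hη⟩ := h
      exact ⟨η, fun _ => hη.1, fun _ => hη⟩
    · refine ⟨0, fun hi => ?_, fun h' => absurd h' h⟩
      obtain ⟨t, h1, h2, _⟩ := hf.gap i hi
      exact pos_of_aleph0_le_cof (hκ.trans (h1.trans h2.le))
  choose d hd1 hd2 using hd
  obtain ⟨β, hβ, j0, hj0, hj⟩ := hf.f_cofinal d hd1
  obtain ⟨a, ha, hal, hta⟩ := hA (max γ β) (max_lt hγ hβ)
  obtain ⟨j1, hj1, hj1'⟩ := hf.exists_bound_of_small hK (ht a ha) (β := β) fun ζ hζ =>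
    ⟨(le_max_right _ _).trans (hta hζ).1.le, (hta hζ).2⟩
  obtain ⟨i, hi, hiK, η, hη, hbad⟩ := hcon (max j0 j1) (max_lt hj0 hj1)
  obtain ⟨α, hα, hle⟩ := (hd2 i ⟨η, hη, hbad⟩).2 a ha hal
    fun ζ hζ => ⟨(le_max_left _ _).trans_lt (hta hζ).1, (hta hζ).2⟩
  exact (hle.trans_lt (hj i ((le_max_left _ _).trans hi) hiK)).not_ge
    (hj1' i ((le_max_right _ _).trans hi) hiK α hα)

theorem PScale.exists_index {K lam : Ordinal.{0}} {κ μ : Cardinal.{0}} (hκ : ℵ₀ ≤ κ)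
    (hKκ : K = κ.ord) (hκμ : κ < μ) (hlam : μ < lam.cof)
    {g : Ordinal.{0} → Ordinal.{0}} {f : Ordinal.{0} → Ordinal.{0} → Ordinal.{0}}
    (hf : PScale K lam κ μ g f) (hK : K.cof = κ)
    {hh : Ordinal.{0} → Ordinal.{0}} (hhh : ∀ i < K, ∀ b < K, ∃ j, b ≤ j ∧ j < K ∧ hh j = i)
    {A : Set Ordinal.{0}} {t : Ordinal.{0} → Set Ordinal.{0}} (ht : ∀ a ∈ A, CardLT (t a) κ)
    (hA : ∀ b < lam, ∃ a ∈ A, a < lam ∧ t a ⊆ Ioo b lam) {γ : Ordinal.{0}} (hγ : γ < lam) :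
    ∃ β < lam, ∀ u : Set Ordinal.{0}, CardLT u κ → u ⊆ Ioo β lam → ∀ i < K,
      ∃ a ∈ A, a < β ∧ t a ⊆ Ioo γ β ∧ ∀ α ∈ t a, ∀ ζ ∈ u, hh (lastLE K f α ζ) = i := by
  obtain ⟨iA, hiA, hlarge⟩ := hf.eventually_large hκ hK ht hA hγ
  choose! a haA hal hta haf using hlarge
  have hsK : SizeLE (Iio K) κ := hKκ ▸ sizeLE_Iio_ord κ
  have hbig : ∀ i < K, κ < (g i).cof := fun i hi => by
    obtain ⟨t, h1, h2, _⟩ := hf.gap i hi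
    exact h1.trans_lt h2
  have hts : ∀ a ∈ A, SizeLE (t a) κ := fun a ha => by
    obtain ⟨d, hd, hd'⟩ := (ht a ha).exists_sizeLE
    exact hd'.mono subset_rfl hd.le
  -- a bound for the indices and sets chosen
  obtain ⟨β1, hβ1, hb1⟩ : ∃ β1 < lam, ∀ i, iA ≤ i → i < K → ∀ η ∈ ladder (g i),
      a i η < β1 ∧ ∀ α ∈ t (a i η), α < β1 := by
    obtain ⟨b, hb, hb'⟩ := (hsK.mono (sep_subset _ (iA ≤ ·)) le_rfl).exists_bound_choice
      (hκμ.trans hlam) (P := fun i b => ∀ η ∈ ladder (g i), ∃ b' < b,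
        a i η < b' ∧ ∀ α ∈ t (a i η), α < b') fun i hi => by
        refine (sizeLE_ladder (g i)).exists_bound_choice ((hf.cof_lt i hi.1).trans hlam)
          fun η hη => ?_
        have hη' := ladder_subset _ hη
        obtain ⟨b, hb, hb'⟩ := (hts _ (haA i hi.2 hi.1 η hη')).exists_bound (hκμ.trans hlam)
          fun α hα => (hta i hi.2 hi.1 η hη' hα).2
        have h2 := succ_lt_of_aleph0_le_cof (hκ.trans (hκμ.trans hlam).le)
          (hal i hi.2 hi.1 η hη')
        exact ⟨max b (a i η + 1), max_lt hb h2,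
          (Order.lt_add_one_iff.2 le_rfl).trans_le (le_max_right _ _),
          fun α hα => (hb' α hα).trans_le (le_max_left _ _)⟩
    refine ⟨b, hb, fun i hi hiK η hη => ?_⟩
    obtain ⟨b1, hb1, h1⟩ := hb' i ⟨hiK, hi⟩
    obtain ⟨b2, hb2, h2, h3⟩ := h1 η hη
    exact ⟨h2.trans (hb2.trans hb1), fun α hα => (h3 α hα).trans (hb2.trans hb1)⟩
  have hF : ∀ j < K, ∃ b < g j, ∀ i, iA ≤ i → i < j → ∀ η ∈ ladder (g i), ∀ α ∈ t (a i η),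
      f α j < b := by
    intro j hj
    obtain ⟨τ, hτ1, hτ2, hτ3⟩ := hf.gap j hj
    have hsub : {i ∈ Iio K | iA ≤ i ∧ i < j} ⊆ Iio K := sep_subset _ _
    obtain ⟨b, hb, hb'⟩ := (hsK.mono hsub hτ1).exists_bound_choice hτ2
      (P := fun i b => ∀ η ∈ ladder (g i), ∃ b' < b, ∀ α ∈ t (a i η), f α j < b') fun i hi => by
        refine ((sizeLE_ladder (g i)).mono subset_rfl (hτ3 i hi.2.2)).exists_bound_choice hτ2
          fun η hη => ?_
        have hη' := ladder_subset _ hη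
        exact ((hts _ (haA i hi.2.1 hi.1 η hη')).mono subset_rfl hτ1).exists_bound_image hτ2
          fun α hα => hf.f_lt α (hta i hi.2.1 hi.1 η hη' hα).2 j hj
    refine ⟨b, hb, fun i hi hij η hη α hα => ?_⟩
    obtain ⟨b1, hb1, h1⟩ := hb' i ⟨hij.trans hj, hi, hij⟩
    obtain ⟨b2, hb2, h2⟩ := h1 η hη
    exact (h2 α hα).trans (hb2.trans hb1)
  choose! F hF1 hF2 using hF
  obtain ⟨β2, hβ2, j0, hj0, hj0'⟩ := hf.f_cofinal F hF1
  refine ⟨max β1 β2, max_lt hβ1 hβ2, fun u hu hul i hi => ?_⟩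
  obtain ⟨j1, hj1, hj1'⟩ := hf.exists_bound_of_small hK hu (β := β2) fun ζ hζ =>
    ⟨(le_max_right _ _).trans (hul hζ).1.le, (hul hζ).2⟩
  obtain ⟨j, hj, hjK, hji⟩ := hhh i hi (max iA (max j0 j1)) (max_lt hiA (max_lt hj0 hj1))
  have hjA : iA ≤ j := (le_max_left _ _).trans hj
  have hjj0 : j0 ≤ j := (le_max_left _ _).trans ((le_max_right _ _).trans hj)
  have hjj1 : j1 ≤ j := (le_max_right _ _).trans ((le_max_right _ _).trans hj)
  obtain ⟨d, hd, hud⟩ := hu.exists_sizeLE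
  obtain ⟨η0, hη0, hη0'⟩ := hud.exists_bound_image (hd.trans (hbig j hjK)) (f := fun ζ => f ζ j)
    fun ζ hζ => hf.f_lt ζ (hul hζ).2 j hjK
  obtain ⟨η, hη, hη0η⟩ := exists_mem_ladder hη0
  have hηg := ladder_subset _ hη
  obtain ⟨hb2, hb3⟩ := hb1 j hjA hjK η hη
  refine ⟨a j η, haA j hjA hjK η hηg, hb2.trans_le (le_max_left _ _), fun α hα => ⟨?_, ?_⟩,
    fun α hα ζ hζ => ?_⟩
  · exact (hta j hjA hjK η hηg hα).1
  · exact (hb3 α hα).trans_le (le_max_left _ _)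
  · rw [lastLE_eq hjK ?_ ?_, hji]
    · exact (hη0' ζ hζ).le.trans (hη0η.trans (haf j hjA hjK η hηg α hα).le)
    · intro l hjl hlK
      exact ((hF2 l hlK j hjA hjl η hη α hα).trans (hj0' l (hjj0.trans hjl.le) hlK)).trans_le
        (hj1' l (hjj1.trans hjl.le) hlK ζ hζ)

/-! ### From stationary sets to families of small sets -/

/-- All but boundedly many members of a disjoint family lie above a given point. -/
theorem exists_forall_subset_Ioo {c : Cardinal.{0}} (hc : c.IsRegular)
    {t : Ordinal.{0} → Set Ordinal.{0}} (ht : ∀ a < c.ord, t a ⊆ Iio c.ord)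
    (hdisj : ∀ a b, a < c.ord → b < c.ord → a ≠ b → Disjoint (t a) (t b)) {δ : Ordinal.{0}}
    (hδ : δ < c.ord) : ∃ b < c.ord, ∀ a, b ≤ a → a < c.ord → t a ⊆ Ioo δ c.ord := by
  have hδ1 := succ_lt_of_aleph0_le_cof (by rw [hc.cof_ord]; exact hc.aleph0_le) hδ
  have h0 := pos_of_aleph0_le_cof (o := c.ord) (by rw [hc.cof_ord]; exact hc.aleph0_le)
  obtain ⟨b, hb, hb'⟩ := (sizeLE_Iio (δ + 1)).exists_bound_choice (cof_ord_lt hc hδ1)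
    (P := fun x a => ∀ a' < c.ord, x ∈ t a' → a' = a) (fun x _ => by
      by_cases h : ∃ a < c.ord, x ∈ t a
      · obtain ⟨a, ha, hx⟩ := h
        refine ⟨a, ha, fun a' ha' hx' => ?_⟩
        by_contra hne
        exact disjoint_left.1 (hdisj a' a ha' ha hne) hx' hx
      · exact ⟨0, h0, fun a' ha' hx' => absurd ⟨a', ha', hx'⟩ h⟩)
  refine ⟨b, hb, fun a hba ha x hx => ⟨?_, ht a ha hx⟩⟩
  by_contra! hle
  obtain ⟨y, hy, hy'⟩ := hb' x (Order.lt_add_one_iff.2 hle)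
  exact (hy' a ha hx ▸ hy).not_ge hba

/-- Points `y` hit by walks from unboundedly many of the sets `t a`, uniformly above `γ`, with
`low` in the interval `[γ0, γ]`. -/
def hitSet (E : Set Ordinal.{0}) (m : Cardinal.{0}) (t : Ordinal.{0} → Set Ordinal.{0})
    (lam γ0 γ : Ordinal.{0}) : Set Ordinal.{0} :=
  {y | y < lam ∧ γ < y ∧ ∀ b < lam, ∃ a, b ≤ a ∧ a < lam ∧ ∀ ζ ∈ t a, y < ζ ∧
    ∀ x, γ < x → x < y → hit E m x ζ = y ∧ γ0 ≤ low E m x ζ ∧ low E m x ζ ≤ γ}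

theorem exists_stationary_hitSet {c : Cardinal.{0}} (hc : c.IsRegular) {κ : Cardinal.{0}}
    (hκ : ℵ₀ ≤ κ) (hκr : κ.IsRegular) (hκc : κ < c) {m : Ordinal.{0} → Cardinal.{0}}
    (hm : ∀ i j, i ≤ j → j < κ.ord → m i ≤ m j) (hmκ : ∀ i < κ.ord, κ ≤ m i)
    (hcof : ∀ ζ < c.ord, ∃ i < κ.ord, ζ.cof ≤ m i)
    {E : Set Ordinal.{0}} (hE : ∀ D, IsClubIn D c.ord → ∃ δ ∈ D, δ.cof = Order.succ κ ∧
      ∀ i ∈ Iio κ.ord, ∀ x < δ, ∃ y, x < y ∧ y < δ ∧ y ∈ D ∧ m i < y.cof ∧ Reach E (m i) δ y)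
    {t : Ordinal.{0} → Set Ordinal.{0}} (ht : ∀ a < c.ord, t a ⊆ Iio c.ord)
    (hdisj : ∀ a b, a < c.ord → b < c.ord → a ≠ b → Disjoint (t a) (t b))
    (hcard : ∀ a < c.ord, CardLT (t a) κ) :
    ∃ i < κ.ord, ∀ γ0 < c.ord, ∃ γ < c.ord, IsStatIn (hitSet E (m i) t c.ord γ0 γ) c.ord := by
  have hu : ℵ₀ < c := hκ.trans_lt hκc
  have hcc : c.ord.cof = c := hc.cof_ord
  have hκκ : κ.ord.cof = κ := hκr.cof_ord
  have hK0 : 0 < κ.ord := pos_of_aleph0_le_cof (by rwa [hκκ])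
  by_contra! hcon
  choose! γ0 hγ0 hnot using hcon
  have hclub : ∀ i < κ.ord, ∀ γ < c.ord, ∃ C, IsClubIn C c.ord ∧
      ∀ y ∈ hitSet E (m i) t c.ord (γ0 i) γ, y ∉ C := by
    intro i hi γ hγ
    by_contra! h
    refine hnot i hi γ hγ ⟨fun y hy => hy.1, fun C hC => ?_⟩
    obtain ⟨y, hy, hy'⟩ := h C hC
    exact ⟨y, hy, hy'⟩
  choose! C hC hCn using hclub
  obtain ⟨b0, hb0, hb0'⟩ := (sizeLE_Iio_ord κ).exists_bound_image (o := c.ord) (f := γ0)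
    (by rwa [hcc]) hγ0
  have hD := (isClubIn_diag hc hu (C := fun γ => {y | y < c.ord ∧ ∀ i ∈ Iio κ.ord, y ∈ C i γ})
    fun γ hγ => isClubIn_biInter hc hu (sizeLE_Iio_ord κ) hκc fun i hi => hC i hi γ hγ).inter
      hc hu (isClubIn_Ioo hc hb0)
  obtain ⟨δ, ⟨-, hδb, hδc⟩, hδs, hguess⟩ := hE _ hD
  have hδcof : κ < δ.cof := by rw [hδs]; exact Order.lt_succ κ
  obtain ⟨b, hb, hbt⟩ := exists_forall_subset_Ioo hc ht hdisj hδc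
  let P : Ordinal.{0} → Ordinal.{0} → Ordinal.{0} → Prop := fun a i γ =>
    ∀ ζ ∈ t a, ∀ y, γ < y → y < δ → m i < y.cof → Reach E (m i) δ y →
      ∃ γ' < y, GoodAt E (m i) δ ζ y γ'
  have hP : ∀ a, b ≤ a → a < c.ord → ∃ i < κ.ord, ∃ γ < δ, P a i γ := by
    intro a hba ha
    obtain ⟨d, hd, hdt⟩ := (hcard a ha).exists_sizeLE
    obtain ⟨i, hi, hi'⟩ := hdt.exists_bound_choice (o := κ.ord) (hd.trans_eq hκκ.symm) fun ζ hζ =>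
      exists_goodAt (E := E) hK0 hm (fun i hi => hκ.trans (hmκ i hi)) hcof (hκ.trans_lt hδcof) ζ
        (hbt a hba ha hζ).1 (hbt a hba ha hζ).2
    refine ⟨i, hi, ?_⟩
    obtain ⟨γ, hγ, hγ'⟩ := hdt.exists_bound_choice (hd.trans hδcof) fun ζ hζ =>
      let ⟨j, hj, hj'⟩ := hi' ζ hζ
      hj' i hj.le hi
    refine ⟨γ, hγ, fun ζ hζ y hy => ?_⟩
    obtain ⟨γ1, hγ1, h⟩ := hγ' ζ hζ
    exact h y (hγ1.trans hy)
  obtain ⟨i, hi, hi'⟩ := exists_unbounded_fiber (U := Ici b) (sizeLE_Iio_ord κ) (o := c.ord)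
    (by rwa [hcc]) (fun x hx => ⟨max b x, mem_Ici.2 (le_max_left b x), le_max_right _ _, max_lt hb hx⟩)
    (P := fun a i => ∃ γ < δ, P a i γ) fun a ha hac => hP a ha hac
  obtain ⟨γ, hγ, hγ'⟩ := exists_unbounded_fiber
    (U := {a | b ≤ a ∧ ∃ γ < δ, P a i γ}) (sizeLE_Iio δ) (cof_ord_lt hc hδc)
    (fun x hx => by
      obtain ⟨a, h1, h2, h3, h4⟩ := hi' x hx
      exact ⟨a, ⟨h1, h4⟩, h2, h3⟩)
    (P := fun a γ => P a i γ) fun a ha hac => ha.2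
  obtain ⟨y0, hy0, hy0δ, -, -, hr0⟩ := hguess i hi (max γ b0) (max_lt hγ hδb)
  obtain ⟨y, hy0y, hyδ, hyD, hym, hr⟩ := hguess i hi y0 hy0δ
  have hyc := hyδ.trans hδc
  have hγy : γ < y := ((le_max_left _ _).trans_lt hy0).trans hy0y
  obtain ⟨γ1, hγ1, hγ1'⟩ := exists_unbounded_fiber
    (U := {a | b ≤ a ∧ P a i γ}) (sizeLE_Iio y) (cof_ord_lt hc hyc)
    (fun x hx => by
      obtain ⟨a, h1, h2, h3, h4⟩ := hγ' x hx
      exact ⟨a, ⟨h1.1, h4⟩, h2, h3⟩)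
    (P := fun a γ' => ∀ ζ ∈ t a, GoodAt E (m i) δ ζ y γ') (fun a ha hac => by
      obtain ⟨d, hd, hdt⟩ := (hcard a hac).exists_sizeLE
      obtain ⟨γ', hγ', h⟩ := hdt.exists_bound_choice (hd.trans ((hmκ i hi).trans_lt hym))
        fun ζ hζ => ha.2 ζ hζ y hγy hyδ hym hr
      refine ⟨γ', hγ', fun ζ hζ => ?_⟩
      obtain ⟨γ2, h2, h3⟩ := h ζ hζ
      exact h3.mono h2.le)
  have hmax : max γ1 y0 < y := max_lt hγ1 hy0y
  refine hCn i hi (max γ1 y0) (hmax.trans hyc) y ⟨hyc, hmax, fun b' hb' => ?_⟩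
    ((hyD.1.2 _ hmax).2 i hi)
  obtain ⟨a, ⟨hba, -⟩, hb'a, hac, hg⟩ := hγ1' b' hb'
  refine ⟨a, hb'a, hac, fun ζ hζ => ⟨hyδ.trans (hbt a hba hac hζ).1, fun x hx hxy => ?_⟩⟩
  obtain ⟨h1, h2, h3⟩ := hg ζ hζ x ((le_max_left _ _).trans_lt hx) hxy
  refine ⟨h1, ?_, h2.trans (le_max_left _ _)⟩
  exact ((hb0' i hi).trans ((le_max_right _ _).trans_lt hy0)).le.trans
    (h3 y0 hr0 ((le_max_right _ _).trans_lt hx))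

/-- The colouring transferring `d` along walks. -/
def walkColor (E : Set Ordinal.{0}) (m : Ordinal.{0} → Cardinal.{0})
    (idx d : Ordinal.{0} → Ordinal.{0} → Ordinal.{0}) (lam α β : Ordinal.{0}) : Ordinal.{0} :=
  open Classical in
  if hit E (m (idx α β)) (low E (m (idx α β)) α β) α < hit E (m (idx α β)) α β ∧
      hit E (m (idx α β)) α β < lam then
    d (hit E (m (idx α β)) (low E (m (idx α β)) α β) α) (hit E (m (idx α β)) α β)
  else 0

theorem pr1_of_stationary {mu theta : Cardinal.{0}} (hsing : _root_.IsSingular mu)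
    {g : Ordinal.{0} → Ordinal.{0}} {f : Ordinal.{0} → Ordinal.{0} → Ordinal.{0}}
    (hf : PScale (cofOrd mu) (sucOrd mu) (Ordinal.cof mu.ord) mu g f)
    (hgs : ∀ i < cofOrd mu, Order.succ (Ordinal.cof mu.ord) ≤ (g i).cof)
    {d : Ordinal.{0} → Ordinal.{0} → Ordinal.{0}}
    (hd : ∀ a b, a < b → b < sucOrd mu → d a b < theta.ord)
    (hdS : ∀ S T : Set Ordinal.{0}, IsStatIn S (sucOrd mu) → IsStatIn T (sucOrd mu) →
      ∀ ς, ς < theta.ord → ∃ α ∈ S, ∃ β ∈ T, α < β ∧ d α β = ς) : Pr1 mu theta := by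
  unfold cofOrd sucOrd at *
  obtain ⟨hmu, hκmu⟩ := hsing
  have hlim := isSuccLimit_ord hmu
  set κ := Ordinal.cof mu.ord with hκdef
  have hκ : ℵ₀ ≤ κ := (isRegular_cof hlim).aleph0_le
  have hκr : κ.IsRegular := isRegular_cof hlim
  have hc : (Order.succ mu).IsRegular := isRegular_succ hmu
  set c := Order.succ mu with hcdef
  have hcc : c.ord.cof = c := hc.cof_ord
  have hmuc : mu < c := Order.lt_succ mu
  have hκc : κ < c := hκmu.trans hmuc
  have hu : ℵ₀ < c := hκ.trans_lt hκc
  have hsκ : Order.succ κ ≤ mu := Order.succ_le_of_lt hκmu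
  set m : Ordinal.{0} → Cardinal.{0} := fun i => (g i).cof with hmdef
  have hm : ∀ i j, i ≤ j → j < κ.ord → m i ≤ m j := by
    intro i j hij hj
    rcases hij.eq_or_lt with rfl | h
    · exact le_rfl
    · obtain ⟨t, -, h2, h3⟩ := hf.gap j hj
      exact (h3 i h).trans h2.le
  have hmκ : ∀ i < κ.ord, κ ≤ m i := fun i hi => (Order.le_succ κ).trans (hgs i hi)
  have hssκ : Order.succ (Order.succ κ) < c := by
    obtain ⟨i, hi, h⟩ := hf.cofinal 0 (aleph0_pos.trans_le hmu)
    refine lt_of_le_of_lt (Order.succ_le_of_lt ?_) hmuc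
    exact (hgs i hi).trans_lt (hf.cof_lt i hi)
  obtain ⟨E, -, hE⟩ := exists_club_guess hc hu (isRegular_succ hκ) hssκ (sizeLE_Iio_ord κ)
    (Order.le_succ κ) m fun i hi => ⟨hgs i hi,
      (Order.succ_le_of_lt (hf.cof_lt i hi)).trans_lt hmuc⟩
  have hcof : ∀ ζ < c.ord, ∃ i < κ.ord, ζ.cof ≤ m i := by
    intro ζ hζ
    have h1 : ζ.cof ≤ mu := (cof_le_card ζ).trans (Order.lt_succ_iff.1 (lt_ord.1 hζ))
    have h2 : ζ.cof ≠ mu := by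
      intro h
      have h3 := congrArg (fun x => Ordinal.cof x.ord) h
      simp only [cof_ord_cof] at h3
      exact hκmu.ne (h3.symm.trans h)
    obtain ⟨i, hi, h⟩ := hf.cofinal _ (lt_of_le_of_ne h1 h2)
    exact ⟨i, hi, h.le⟩
  obtain ⟨hh, hhh⟩ := exists_cofinally_onto hκ
  set idx := fun α ζ => hh (lastLE κ.ord f α ζ) with hidx
  have h0c : 0 < c.ord := pos_of_aleph0_le_cof (by rw [hcc]; exact hu.le)
  have h1c : (0 : Ordinal.{0}) + 1 < c.ord :=
    succ_lt_of_aleph0_le_cof (by rw [hcc]; exact hu.le) h0c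
  have hθ : 0 < theta.ord := bot_le.trans_lt (hd 0 (0 + 1) (by simp) h1c)
  refine ⟨walkColor E m idx d c.ord, fun a b hab hb => ?_, ?_⟩
  · unfold walkColor
    split_ifs with h
    · exact hd _ _ h.1 h.2
    · exact hθ
  intro t ht hdisj hcard ε hε
  obtain ⟨i, hi, hst⟩ := exists_stationary_hitSet hc hκ hκr hκc hm hmκ hcof hE ht hdisj hcard
  obtain ⟨γS, hγS, hS⟩ := hst 0 h0c
  obtain ⟨γT, hγT, hT⟩ := hst (γS + 1)
    (succ_lt_of_aleph0_le_cof (by rw [hcc]; exact hu.le) hγS)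
  let A : Ordinal.{0} → Set Ordinal.{0} := fun y => {a | a < c.ord ∧ ∀ ζ ∈ t a, y < ζ ∧
    ∀ x, γS < x → x < y → hit E (m i) x ζ = y}
  have hind : ∀ y < c.ord, ∃ β < c.ord, y ∈ hitSet E (m i) t c.ord 0 γS →
      ∀ u : Set Ordinal.{0}, CardLT u κ → u ⊆ Ioo β c.ord →
      ∃ a ∈ A y, a < β ∧ t a ⊆ Ioo γT β ∧ ∀ α ∈ t a, ∀ ζ ∈ u, idx α ζ = i := by
    intro y hy
    by_cases hyS : y ∈ hitSet E (m i) t c.ord 0 γS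
    · obtain ⟨β, hβ, h⟩ := hf.exists_index hκ rfl hκmu (by rwa [hcc]) hκr.cof_ord hhh
        (A := A y) (t := t) (fun a ha => hcard a ha.1) (fun b hb => by
          obtain ⟨b', hb', hbt⟩ := exists_forall_subset_Ioo hc ht hdisj hb
          obtain ⟨a, h1, h2, h3⟩ := hyS.2.2 b' hb'
          exact ⟨a, ⟨h2, fun ζ hζ => ⟨(h3 ζ hζ).1, fun x hx hxy => ((h3 ζ hζ).2 x hx hxy).1⟩⟩, h2,
            hbt a h1 h2⟩) hγT
      exact ⟨β, hβ, fun _ u hu' huβ => h u hu' huβ i hi⟩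
    · exact ⟨0, h0c, fun h => absurd h hyS⟩
  choose! B hB hB' using hind
  obtain ⟨α', ⟨hα', hα'T, -⟩, β', ⟨hβ', -, hβ'B⟩, hlt, hdε⟩ := hdS _ _
    (hS.inter_club hc hu (isClubIn_Ioo hc hγT))
    (hT.inter_club hc hu (isClubIn_closure_points hc hu hB)) ε hε
  have hBβ := hβ'B α' hlt
  obtain ⟨b, hβb, hbc, hbt⟩ := hβ'.2.2 β' hβ'.1
  obtain ⟨a, haA, haB, hta, hai⟩ := hB' α' hα'.1 hα' (t b) (hcard b hbc) fun ζ hζ =>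
    ⟨hBβ.trans (hbt ζ hζ).1, ht b hbc hζ⟩
  refine ⟨a, b, (haB.trans hBβ).trans_le hβb, hbc, fun ξ hξ ζ hζ => ?_⟩
  have hξβ : ξ < β' := (hta hξ).2.trans hBβ
  have hξζ : ξ < ζ := hξβ.trans (hbt ζ hζ).1
  obtain ⟨h1, h2, h3⟩ := (hbt ζ hζ).2 ξ (hta hξ).1 hξβ
  have h4 := (haA.2 ξ hξ).2 _ (Order.add_one_le_iff.1 h2) (h3.trans_lt hα'T)
  rw [min_eq_left hξζ.le, max_eq_right hξζ.le]
  unfold walkColor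
  rw [hai ξ hξ ζ hζ, h1, h4, if_pos ⟨hlt, hβ'.1⟩, hdε]

/-! ### Guessing clubs by subsets -/

theorem exists_club_guess_subset {c : Cardinal.{0}} (hc : c.IsRegular) (hu : ℵ₀ < c)
    {s : Cardinal.{0}} (hs : s.IsRegular) (hsc : Order.succ s < c) :
    ∃ C : Ordinal.{0} → Set Ordinal.{0}, ∀ D, IsClubIn D c.ord → ∃ α < c.ord, α.cof = s ∧
      C α ⊆ Iio α ∩ D ∧ ∀ x < α, ∃ y ∈ C α, x ≤ y := by
  by_contra! hcon
  let C : Set Ordinal.{0} → Ordinal.{0} → Set Ordinal.{0} := fun E α =>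
    {y | y ≠ 0 ∧ ∃ x ∈ ladder α, sSup (E ∩ Iic x) = y}
  choose N hN hN' using fun E => hcon (C E)
  obtain ⟨E, hE, hanti, hEN⟩ := exists_club_iteration hc hu N fun E _ => hN E
  have hρr : (Order.succ s).IsRegular := isRegular_succ hs.aleph0_le
  set ρ := (Order.succ s).ord with hρ
  have hρc : ρ < c.ord := ord_lt_ord.2 hsc
  have hρcof : ρ.cof = Order.succ s := hρr.cof_ord
  have hsρ : s < ρ.cof := by rw [hρcof]; exact Order.lt_succ s
  have hρ0 : 0 < ρ := pos_of_aleph0_le_cof (by rw [hρcof]; exact hρr.aleph0_le)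
  have hscc : s < c := (Order.lt_succ s).trans hsc
  choose! F hF1 hF2 hF3 using fun x hx => (hE ρ hρc).exists_gt hc (x := x) hx
  obtain ⟨α, ⟨hαl, hαF⟩, -, hαs⟩ := (isClubIn_closure_points hc hu hF3).exists_cof_eq hc hs hscc
    (pos_of_aleph0_le_cof (o := c.ord) (by rw [hc.cof_ord]; exact hc.aleph0_le))
  obtain ⟨k, hk, hkb⟩ := (sizeLE_ladder α).exists_bound_choice (o := ρ) (by rwa [hαs])
    fun x _ => exists_stable (fun k => sSup (E k ∩ Iic x)) hρ0 fun k l hkl _ =>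
      csSup_le_csSup' ⟨x, fun _ h => h.2⟩ (inter_subset_inter_left _ (hanti k l hkl))
  have hk1 : k + 1 < ρ := succ_lt_of_aleph0_le_cof (by rw [hρcof]; exact hρr.aleph0_le) hk
  have hkk : k < k + 1 := Order.lt_add_one_iff.2 le_rfl
  obtain ⟨x, hx, hxC⟩ := hN' (E k) α hαl hαs (by
    rintro _ ⟨hy0, x, hx, rfl⟩
    have hxα := ladder_subset _ hx
    refine ⟨(sSup_inter_Iic_le _ _).trans_lt hxα, hEN k (k + 1) hkk ?_⟩
    obtain ⟨k0, hk0, hst⟩ := hkb x hx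
    have heq := (hst k hk0.le hk).trans (hst (k + 1) (hk0.trans hkk).le hk1).symm
    change sSup _ = sSup _ at heq
    rw [heq] at hy0 ⊢
    refine (hE _ (hk1.trans hρc)).2.1.sSup_mem inter_subset_left ?_ (fun y hy => hy.2)
      (hxα.trans hαl)
    rw [nonempty_iff_ne_empty]
    intro h
    exact hy0 (by rw [h, csSup_empty]; rfl))
  have hxc := hx.trans hαl
  obtain ⟨z, hz, hFz⟩ := exists_mem_ladder (hαF x hx)
  have hle : F x ≤ sSup (E k ∩ Iic z) :=
    le_csSup ⟨z, fun _ h => h.2⟩ ⟨hanti k ρ hk.le (hF1 x hxc), hFz⟩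
  have hlt := (hF2 x hxc).trans_le hle
  exact hlt.not_gt (hxC _ ⟨(bot_le.trans_lt hlt).ne', z, hz, rfl⟩)

/-! ### Functions modulo bounded sets -/

/-- `P` holds at all sufficiently large points below `K`. -/
def EvBelow (K : Ordinal.{0}) (P : Ordinal.{0} → Prop) : Prop :=
  ∃ i0 < K, ∀ i, i0 ≤ i → i < K → P i

theorem EvBelow.mono {K : Ordinal.{0}} {P Q : Ordinal.{0} → Prop} (h : EvBelow K P)
    (hPQ : ∀ i < K, P i → Q i) : EvBelow K Q :=
  let ⟨i0, h0, h⟩ := h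
  ⟨i0, h0, fun i hi hiK => hPQ i hiK (h i hi hiK)⟩

theorem EvBelow.and {K : Ordinal.{0}} {P Q : Ordinal.{0} → Prop} (hP : EvBelow K P)
    (hQ : EvBelow K Q) : EvBelow K fun i => P i ∧ Q i :=
  let ⟨i0, h0, hP⟩ := hP
  let ⟨i1, h1, hQ⟩ := hQ
  ⟨max i0 i1, max_lt h0 h1, fun i hi hiK =>
    ⟨hP i ((le_max_left _ _).trans hi) hiK, hQ i ((le_max_right _ _).trans hi) hiK⟩⟩

/-- An eventually strictly increasing sequence of functions below the successors of `n i`, which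
increases everywhere along closed unbounded subsets `E β` when `β` has small cofinality. -/
structure Climbing (κ μ : Cardinal.{0}) (n : Ordinal.{0} → Cardinal.{0})
    (E : Ordinal.{0} → Set Ordinal.{0}) (f : Ordinal.{0} → Ordinal.{0} → Ordinal.{0}) : Prop where
  le_n : ∀ i, κ ≤ n i
  n_lt : ∀ i < κ.ord, n i < μ
  n_cofinal : ∀ t < μ, EvBelow κ.ord fun i => t ≤ n i
  f_lt : ∀ β < (Order.succ μ).ord, ∀ i < κ.ord, f β i < (Order.succ (n i)).ord
  f_strict : ∀ α β, α < β → β < (Order.succ μ).ord → EvBelow κ.ord fun i => f α i < f β i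
  E_closed : ∀ β, ClosedIn (E β) β
  E_unbdd : ∀ β, ∀ x < β, ∃ y ∈ E β, x ≤ y ∧ y < β
  f_lt_of_mem : ∀ β < (Order.succ μ).ord, ∀ i < κ.ord, β.cof ≤ n i → ∀ x ∈ E β, f x i < f β i

theorem succ_lt_of_cof_lt {μ : Cardinal.{0}} (hμ : ℵ₀ ≤ μ) (hcof : μ.ord.cof < μ) {t : Cardinal.{0}}
    (ht : t < μ) : Order.succ t < μ := by
  refine lt_of_le_of_ne (Order.succ_le_of_lt ht) fun h => ?_
  rcases lt_or_ge t ℵ₀ with h4 | h3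
  · obtain ⟨k, rfl⟩ := lt_aleph0.1 h4
    have h5 : Order.succ (k : Cardinal.{0}) < ℵ₀ := by
      rw [succ_natCast]
      exact_mod_cast natCast_lt_aleph0 (n := k + 1)
    exact (h ▸ h5).not_ge hμ
  · have h4 := (isRegular_succ h3).cof_ord
    rw [h] at h4
    exact hcof.ne h4

theorem exists_filtration {κ μ : Cardinal.{0}} (hκ : ℵ₀ ≤ κ) (hcof : μ.ord.cof = κ)
    (hκμ : κ < μ) : ∃ n : Ordinal.{0} → Cardinal.{0}, (∀ i, κ ≤ n i) ∧ (∀ i < κ.ord, n i < μ) ∧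
      (∀ i j, i ≤ j → n i ≤ n j) ∧ ∀ t < μ, EvBelow κ.ord fun i => t ≤ n i := by
  have hlad := sizeLE_ladder μ.ord
  rw [hcof] at hlad
  have h1 : #(ladder μ.ord) ≤ #(Iio κ.ord) := by
    rw [Cardinal.mk_Iio_ordinal, card_ord]; exact hlad
  have hmu0 : 0 < μ.ord := pos_of_aleph0_le_cof (by rwa [hcof])
  obtain ⟨y0, hy0, -⟩ := exists_mem_ladder hmu0
  obtain ⟨e⟩ := h1
  have : Nonempty (ladder μ.ord) := ⟨⟨y0, hy0⟩⟩
  classical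
  let F : Ordinal.{0} → Ordinal.{0} := fun i =>
    if h : i ∈ Iio κ.ord then (Function.invFun e ⟨i, h⟩ : ladder μ.ord) else 0
  have hF : ∀ i, F i < μ.ord := fun i => by
    unfold F
    split_ifs with h
    · exact ladder_subset _ (Subtype.mem _)
    · exact hmu0
  have hF' : ∀ y ∈ ladder μ.ord, ∃ i < κ.ord, F i = y := fun y hy => by
    refine ⟨(e ⟨y, hy⟩ : Iio κ.ord), (e ⟨y, hy⟩).2, ?_⟩
    unfold F
    rw [dif_pos (e ⟨y, hy⟩).2]
    simp [Function.leftInverse_invFun e.injective _]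
  have hbdd : ∀ i, BddAbove (F '' Iic i) := fun i =>
    ⟨μ.ord, by rintro _ ⟨j, -, rfl⟩; exact (hF j).le⟩
  have hκr := isRegular_cof (isSuccLimit_ord (hκ.trans hκμ.le))
  rw [hcof] at hκr
  have hmono : ∀ i j, i ≤ j → max κ (sSup (F '' Iic i)).card ≤ max κ (sSup (F '' Iic j)).card :=
    fun i j hij => max_le_max le_rfl (Ordinal.card_le_card
      (csSup_le_csSup' (hbdd j) (image_mono (Iic_subset_Iic.2 hij))))
  refine ⟨fun i => max κ (sSup (F '' Iic i)).card, fun i => le_max_left _ _, fun i hi =>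
    max_lt hκμ (lt_ord.1 ?_), hmono, fun t ht => ?_⟩
  · have hi1 : i + 1 < κ.ord := succ_lt_of_aleph0_le_cof (by rwa [hκr.cof_ord]) hi
    obtain ⟨b, hb, hb'⟩ := (sizeLE_Iio (i + 1)).exists_bound_image (o := μ.ord) (f := F)
      (by rw [hcof]; exact lt_ord.1 hi1) fun x _ => hF x
    refine lt_of_le_of_lt (csSup_le' ?_) hb
    rintro _ ⟨j, hj, rfl⟩
    exact (hb' j (mem_Iio.2 (Order.lt_add_one_iff.2 (mem_Iic.1 hj)))).le
  · obtain ⟨y, hy, hty⟩ := exists_mem_ladder (ord_lt_ord.2 ht)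
    obtain ⟨i, hi, rfl⟩ := hF' y hy
    refine ⟨i, hi, fun j hij hj => le_trans ?_ (hmono i j hij)⟩
    refine le_trans ?_ (le_max_right _ _)
    rw [← ord_le]
    exact hty.trans (le_csSup (hbdd i) ⟨i, mem_Iic.2 le_rfl, rfl⟩)

theorem exists_climbing {κ μ : Cardinal.{0}} (hκ : ℵ₀ ≤ κ) (hcof : μ.ord.cof = κ)
    (hκμ : κ < μ) : ∃ n E f, Climbing κ μ n E f := by
  obtain ⟨n, hn, hnμ, hmono, hncof⟩ := exists_filtration hκ hcof hκμ
  have hinj : ∀ β < (Order.succ μ).ord, ∃ e : Ordinal.{0} → Ordinal.{0},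
      InjOn e (Iio β) ∧ ∀ x < β, e x < μ.ord := by
    intro β hβ
    have h1 : #(Iio β) ≤ #(Iio μ.ord) := by
      rw [Cardinal.mk_Iio_ordinal, Cardinal.mk_Iio_ordinal, card_ord, Cardinal.lift_le]
      exact Order.lt_succ_iff.1 (lt_ord.1 hβ)
    obtain ⟨e⟩ := h1
    classical
    refine ⟨fun x => if h : x ∈ Iio β then (e ⟨x, h⟩ : Iio μ.ord) else 0, ?_, fun x hx => ?_⟩
    · intro x hx y hy hxy
      simp only [dif_pos hx, dif_pos hy] at hxy
      exact congrArg Subtype.val (e.injective (Subtype.ext hxy))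
    · simp only [dif_pos (mem_Iio.2 hx)]
      exact Subtype.mem _
  choose! e he he' using hinj
  let E : Ordinal.{0} → Set Ordinal.{0} := fun β => ladder β ∪ limPts (ladder β)
  let V : Ordinal.{0} → Ordinal.{0} → Set Ordinal.{0} := fun β i =>
    {x | x < β ∧ e β x < (n i).ord} ∪ {x | x ∈ E β ∧ β.cof ≤ n i}
  have hEβ : ∀ β, E β ⊆ Iio β := by
    rintro β x (hx | ⟨⟨y, hy, hxy⟩, -⟩)
    · exact ladder_subset _ hx
    · exact mem_Iio.2 (hxy.trans_lt (ladder_subset _ hy))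
  have hVβ : ∀ β i, V β i ⊆ Iio β := by
    rintro β i x (hx | hx)
    · exact hx.1
    · exact hEβ β hx.1
  have hVs : ∀ β < (Order.succ μ).ord, ∀ i, SizeLE (V β i) (n i) := by
    intro β hβ i
    have hni : ℵ₀ ≤ n i := hκ.trans (hn i)
    refine sizeLE_union hni ?_ ?_
    · have h1 : InjOn (e β) {x | x < β ∧ e β x < (n i).ord} := (he β hβ).mono fun x hx => hx.1
      unfold SizeLE
      rw [← mk_image_eq_of_injOn _ _ h1]
      refine (sizeLE_Iio_ord (n i)).mono ?_ le_rfl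
      rintro _ ⟨x, hx, rfl⟩
      exact hx.2
    · by_cases h : β.cof ≤ n i
      · have hl := (sizeLE_ladder β).mono subset_rfl h
        exact (sizeLE_union hni hl ((hl.image _).mono (limPts_subset _) le_rfl)).mono
          (fun x hx => hx.1) le_rfl
      · have h2 : {x | x ∈ E β ∧ β.cof ≤ n i} = ∅ := by
          ext x; simp [h]
        unfold SizeLE
        rw [h2]
        simp
  obtain ⟨f, hf⟩ := exists_rec (X := Ordinal.{0} → Ordinal.{0})
    (fun β G b => b = fun i => sSup ((fun x => G x i + 1) '' V β i)) (fun β G => ⟨_, rfl⟩) (by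
      rintro β G G' b hG rfl
      funext i
      congr 1
      refine image_congr fun x hx => ?_
      rw [hG x (hVβ β i hx)])
  have hf' : ∀ β i, f β i = sSup ((fun x => f x i + 1) '' V β i) := fun β i => congrFun (hf β) i
  have hflt : ∀ i, i < κ.ord → ∀ β, β < (Order.succ μ).ord → f β i < (Order.succ (n i)).ord := by
    intro i hi β
    induction β using WellFoundedLT.induction with
    | ind β ih =>
      intro hβ
      have hr : (Order.succ (n i)).IsRegular := isRegular_succ (hκ.trans (hn i))
      obtain ⟨b, hb, hb'⟩ := (hVs β hβ i).exists_bound_image (o := (Order.succ (n i)).ord)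
        (f := fun x => f x i) (by rw [hr.cof_ord]; exact Order.lt_succ _)
        fun x hx => ih x (hVβ β i hx) ((hVβ β i hx).trans hβ)
      rw [hf']
      refine lt_of_le_of_lt (csSup_le' ?_) hb
      rintro _ ⟨x, hx, rfl⟩
      exact Order.add_one_le_of_lt (hb' x hx)
  have hVf : ∀ β < (Order.succ μ).ord, ∀ i < κ.ord, ∀ x ∈ V β i, f x i < f β i := by
    intro β hβ i hi x hx
    rw [hf' β]
    refine (Order.lt_add_one_iff.2 le_rfl).trans_le (le_csSup ⟨(Order.succ (n i)).ord, ?_⟩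
      ⟨x, hx, rfl⟩)
    rintro _ ⟨y, hy, rfl⟩
    exact Order.add_one_le_of_lt (hflt i hi y ((hVβ β i hy).trans hβ))
  refine ⟨n, E, f, hn, hnμ, hncof, fun β hβ i hi => hflt i hi β hβ, fun α β hαβ hβ => ?_,
    fun β δ hδ h0 h => ?_, fun β x hx => ?_, fun β hβ i hi hc x hx => hVf β hβ i hi x (Or.inr ⟨hx, hc⟩)⟩
  · have hlim : (e β α).card < μ := lt_ord.1 (he' β hβ α hαβ)
    have h2 : Order.succ (e β α).card < μ :=
      succ_lt_of_cof_lt (hκ.trans hκμ.le) (by rwa [hcof]) hlim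
    refine (hncof _ h2).mono fun i hi h => hVf β hβ i hi α (Or.inl ⟨hαβ, lt_ord.2 ?_⟩)
    exact (Order.lt_succ _).trans_le h
  · refine Or.inr ⟨exists_mem_ladder hδ, fun x hx => ?_⟩
    obtain ⟨z, hz | hz, hxz, hzδ⟩ := h x hx
    · exact ⟨z, hz, hxz, hzδ⟩
    · obtain ⟨w, hw, hxw, hwz⟩ := hz.2 x hxz
      exact ⟨w, hw, hxw, hwz.trans hzδ⟩
  · obtain ⟨y, hy, hxy⟩ := exists_mem_ladder hx
    exact ⟨y, Or.inl hy, hxy, ladder_subset _ hy⟩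

/-! ### Small sets of values are crossed only boundedly often -/

theorem isLeast_csInf_inter_Ioi {C : Set Ordinal.{0}} {x y : Ordinal.{0}} (hy : y ∈ C)
    (hxy : x < y) : sInf (C ∩ Ioi x) ∈ C ∧ x < sInf (C ∩ Ioi x) ∧
      ∀ z ∈ C, x < z → sInf (C ∩ Ioi x) ≤ z :=
  have h := csInf_mem (s := C ∩ Ioi x) ⟨y, hy, hxy⟩
  ⟨h.1, h.2, fun _ hz hxz => csInf_le' ⟨hz, hxz⟩⟩

/-- A continuous sequence of ordinals below `c.ord` dominating prescribed functions of its initial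
segments. -/
theorem exists_continuous_sequence {c : Cardinal.{0}} (hc : c.IsRegular) {ρ : Ordinal.{0}}
    (hρ : ρ.card < c) (A : Ordinal.{0} → Set Ordinal.{0})
    (Ψ : Set Ordinal.{0} → Ordinal.{0}) (hΨ : ∀ u, Ψ u < c.ord) :
    ∃ ξ : Ordinal.{0} → Ordinal.{0}, (∀ ν < ρ, ξ ν < c.ord) ∧
      (∀ η ν, η < ν → ν < ρ → ξ η < ξ ν) ∧
      (∀ η ν, η < ν → ν < ρ → ∀ α < ρ, Ψ (ξ '' (A α ∩ Iic η)) < ξ ν) ∧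
      ∀ ν < ρ, (∀ η < ν, η + 1 < ν) → ∀ x < ξ ν, ∃ η < ν, x < ξ η := by
  let Φ : (Ordinal.{0} → Ordinal.{0}) → Ordinal.{0} → Ordinal.{0} := fun G η =>
    sSup ((fun α => max (Ψ (G '' (A α ∩ Iic η))) (G η) + 1) '' Iio ρ)
  obtain ⟨ξ, hξ⟩ := exists_rec (X := Ordinal.{0})
    (fun ν G b => b = sSup (Φ G '' Iio ν)) (fun ν G => ⟨_, rfl⟩) (by
      rintro ν G G' b hG rfl
      congr 1
      refine image_congr fun η hη => ?_
      have h1 : ∀ α, G '' (A α ∩ Iic η) = G' '' (A α ∩ Iic η) := fun α =>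
        image_congr fun x hx => hG x ((mem_Iic.1 hx.2).trans_lt hη)
      simp only [Φ, h1, hG η hη])
  have hlim : ∀ x < c.ord, x + 1 < c.ord := fun x hx =>
    succ_lt_of_aleph0_le_cof (by rw [hc.cof_ord]; exact hc.aleph0_le) hx
  have hΦ : ∀ η, ξ η < c.ord → Φ ξ η < c.ord := by
    intro η hη
    obtain ⟨b, hb, hb'⟩ := (sizeLE_Iio ρ).exists_bound_image (o := c.ord)
      (f := fun α => max (Ψ (ξ '' (A α ∩ Iic η))) (ξ η) + 1) (by rwa [hc.cof_ord])
      fun α _ => hlim _ (max_lt (hΨ _) hη)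
    refine lt_of_le_of_lt (csSup_le' ?_) hb
    rintro _ ⟨α, hα, rfl⟩
    exact (hb' α hα).le
  have hlt : ∀ ν, ν < ρ → ξ ν < c.ord := by
    intro ν
    induction ν using WellFoundedLT.induction with
    | ind ν ih =>
      intro hν
      obtain ⟨b, hb, hb'⟩ := (sizeLE_Iio ν).exists_bound_image (o := c.ord) (f := Φ ξ)
        (by rw [hc.cof_ord]; exact (Ordinal.card_le_card hν.le).trans_lt hρ)
        fun η hη => hΦ η (ih η hη (hη.trans hν))
      rw [hξ ν]
      refine lt_of_le_of_lt (csSup_le' ?_) hb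
      rintro _ ⟨η, hη, rfl⟩
      exact (hb' η hη).le
  have hstep : ∀ η < ρ, ∀ α < ρ, max (Ψ (ξ '' (A α ∩ Iic η))) (ξ η) < Φ ξ η := by
    intro η hη α hα
    refine (Order.lt_add_one_iff.2 le_rfl).trans_le (le_csSup ⟨c.ord, ?_⟩ ⟨α, hα, rfl⟩)
    rintro _ ⟨α', -, rfl⟩
    exact (hlim _ (max_lt (hΨ _) (hlt η hη))).le
  have hle : ∀ η ν, η < ν → ν < ρ → Φ ξ η ≤ ξ ν := by
    intro η ν hην hν
    rw [hξ ν]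
    refine le_csSup ⟨c.ord, ?_⟩ ⟨η, hην, rfl⟩
    rintro _ ⟨η', hη', rfl⟩
    exact (hΦ η' (hlt η' (hη'.trans hν))).le
  refine ⟨ξ, hlt, fun η ν hην hν => ?_, fun η ν hην hν α hα => ?_, fun ν hν hlimν x hx => ?_⟩
  · have h := hstep η (hην.trans hν) η (hην.trans hν)
    exact ((le_max_right _ _).trans_lt h).trans_le (hle η ν hην hν)
  · exact ((le_max_left _ _).trans_lt (hstep η (hην.trans hν) α hα)).trans_le (hle η ν hην hν)
  · rw [hξ ν] at hx
    obtain ⟨_, ⟨η, hη, rfl⟩, hxη⟩ := exists_lt_of_lt_csSup' hx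
    exact ⟨η + 1, hlimν η hη, hxη.trans_le
      (hle η (η + 1) (Order.lt_add_one_iff.2 le_rfl) ((hlimν η hη).trans hν))⟩

/-- Preimages of clubs under continuous sequences are clubs. -/
theorem isClubIn_preimage {c : Cardinal.{0}} (hc : c.IsRegular) (hu : ℵ₀ < c)
    {ξ : Ordinal.{0} → Ordinal.{0}} (hξ : ∀ η ν, η < ν → ν < c.ord → ξ η < ξ ν)
    (hcont : ∀ ν < c.ord, (∀ η < ν, η + 1 < ν) → ∀ x < ξ ν, ∃ η < ν, x < ξ η)
    {δ : Ordinal.{0}} (hδ : ∀ ν < c.ord, ξ ν < δ) (hδ' : ∀ x < δ, ∃ ν < c.ord, x < ξ ν)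
    {E : Set Ordinal.{0}} (hE : ClosedIn E δ) (hEu : ∀ x < δ, ∃ y ∈ E, x ≤ y ∧ y < δ) :
    IsClubIn {ν | ν < c.ord ∧ ξ ν ∈ E} c.ord := by
  have hlim : ∀ x < c.ord, x + 1 < c.ord := fun x hx =>
    succ_lt_of_aleph0_le_cof (by rw [hc.cof_ord]; exact hc.aleph0_le) hx
  have hmono : ∀ η ν, η ≤ ν → ν < c.ord → ξ η ≤ ξ ν := fun η ν hην hν =>
    hην.eq_or_lt.elim (fun h => h ▸ le_rfl) fun h => (hξ η ν h hν).le
  refine ⟨fun ν hν => hν.1, fun ν hν h0 h => ⟨hν, ?_⟩, fun x hx => ?_⟩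
  · have hl : ∀ η < ν, η + 1 < ν := fun η hη => by
      obtain ⟨y, -, hηy, hyν⟩ := h η hη
      exact (Order.add_one_le_of_lt hηy).trans_lt hyν
    refine hE _ (hδ ν hν) (bot_le.trans_lt (hξ 0 ν h0 hν)) fun x hx => ?_
    obtain ⟨η, hη, hxη⟩ := hcont ν hν hl x hx
    obtain ⟨y, hy, hηy, hyν⟩ := h η hη
    exact ⟨ξ y, hy.2, hxη.trans (hξ η y hηy hy.1), hξ y ν hyν hν⟩
  · obtain ⟨ν, hν, hxν, h⟩ := exists_omega_limit (lam := c.ord) (by rwa [hc.cof_ord])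
      (P := fun x y => ∃ e ∈ E, ξ x < e ∧ e < ξ y) (fun x hx => by
        obtain ⟨e, he, hxe, heδ⟩ := hEu _ (hδ (x + 1) (hlim x hx))
        obtain ⟨y, hy, hey⟩ := hδ' e heδ
        have hxe' := (hξ x (x + 1) (Order.lt_add_one_iff.2 le_rfl) (hlim x hx)).trans_le hxe
        refine ⟨y, ?_, hy, e, he, hxe', hey⟩
        by_contra! hle
        exact (hxe'.trans hey).not_ge (hmono y x hle hx)) hx
    refine ⟨ν, ⟨hν, hE _ (hδ ν hν) (bot_le.trans_lt (hξ x ν hxν hν)) fun y hy => ?_⟩, hxν.le, hν⟩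
    have hl : ∀ η < ν, η + 1 < ν := fun η hη => by
      obtain ⟨z, w, hηz, hzw, hwν, -⟩ := h η hη
      exact (Order.add_one_le_of_lt (hηz.trans_lt hzw)).trans_lt hwν
    obtain ⟨η, hη, hyη⟩ := hcont ν hν hl y hy
    obtain ⟨z, w, hηz, hzw, hwν, e, he, hze, hew⟩ := h η hη
    exact ⟨e, he, (hyη.trans_le (hmono η z hηz ((hzw.trans hwν).trans hν))).trans hze,
      hew.trans (hξ w ν hwν hν)⟩

theorem Climbing.mono {κ μ : Cardinal.{0}} {n : Ordinal.{0} → Cardinal.{0}}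
    {E : Ordinal.{0} → Set Ordinal.{0}} {f : Ordinal.{0} → Ordinal.{0} → Ordinal.{0}}
    (hf : Climbing κ μ n E f) (hκ : 0 < κ.ord) {α β : Ordinal.{0}} (hαβ : α ≤ β)
    (hβ : β < (Order.succ μ).ord) : EvBelow κ.ord fun i => f α i ≤ f β i := by
  rcases hαβ.eq_or_lt with rfl | h
  · exact ⟨0, hκ, fun _ _ _ => le_rfl⟩
  · exact (hf.f_strict α β h hβ).mono fun i _ => le_of_lt

theorem Climbing.exists_stable_crossing {κ μ : Cardinal.{0}} (hκ : ℵ₀ ≤ κ) (hcof : μ.ord.cof = κ)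
    (hκμ : κ < μ) {n : Ordinal.{0} → Cardinal.{0}} {E : Ordinal.{0} → Set Ordinal.{0}}
    {f : Ordinal.{0} → Ordinal.{0} → Ordinal.{0}} (hf : Climbing κ μ n E f) {τ : Cardinal.{0}}
    (hκτ : κ ≤ τ) (hτμ : τ < μ) {S : Ordinal.{0} → Set Ordinal.{0}}
    (hS : ∀ i < κ.ord, SizeLE (S i) τ) :
    ∃ α0 < (Order.succ μ).ord, ∀ α, α0 ≤ α → α < (Order.succ μ).ord →
      EvBelow κ.ord fun i => ∀ s ∈ S i, s < f α i → s < f α0 i := by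
  have hμ : ℵ₀ ≤ μ := hκ.trans hκμ.le
  have hcofμ : μ.ord.cof < μ := by rwa [hcof]
  have hc : (Order.succ μ).IsRegular := isRegular_succ hμ
  have hc0 := pos_of_aleph0_le_cof (o := (Order.succ μ).ord) (by rw [hc.cof_ord]; exact hc.aleph0_le)
  have hκr := isRegular_cof (isSuccLimit_ord hμ)
  rw [hcof] at hκr
  have hK0 : 0 < κ.ord := pos_of_aleph0_le_cof (by rwa [hκr.cof_ord])
  by_contra! hcon
  have hnext : ∀ α < (Order.succ μ).ord, ∃ α' < (Order.succ μ).ord, ∀ i0 < κ.ord, ∃ i, i0 ≤ i ∧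
      i < κ.ord ∧ ∃ s ∈ S i, f α i ≤ s ∧ s < f α' i := by
    intro α hα
    obtain ⟨α', -, hα', h⟩ := hcon α hα
    refine ⟨α', hα', ?_⟩
    by_contra! h'
    obtain ⟨i0, hi0, h''⟩ := h'
    refine h ⟨i0, hi0, fun i hi hiK s hs hsα' => ?_⟩
    by_contra! hle
    exact (h'' i hi hiK s hs hle).not_gt hsα'
  choose! nx hnx hnxS using hnext
  set θ := Order.succ τ with hθ
  have hθr : θ.IsRegular := isRegular_succ (hκ.trans hκτ)
  set ρ := Order.succ (Order.succ θ) with hρ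
  have hρr : ρ.IsRegular := isRegular_succ (hθr.aleph0_le.trans (Order.le_succ θ))
  have hρμ : ρ < μ := succ_lt_of_cof_lt hμ hcofμ (succ_lt_of_cof_lt hμ hcofμ
    (succ_lt_of_cof_lt hμ hcofμ hτμ))
  have hρu : ℵ₀ < ρ := (hθr.aleph0_le.trans_lt (Order.lt_succ θ)).trans (Order.lt_succ _)
  have hρc : ρ < Order.succ μ := hρμ.trans (Order.lt_succ μ)
  obtain ⟨C, hC⟩ := exists_club_guess_subset hρr hρu hθr (Order.lt_succ _)
  have hσ : ∀ u : Set Ordinal.{0}, ∃ σ < (Order.succ μ).ord,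
      (∃ σ' < (Order.succ μ).ord, EvBelow κ.ord fun i => ∀ η ∈ u, f η i ≤ f σ' i) →
        EvBelow κ.ord fun i => ∀ η ∈ u, f η i ≤ f σ i := by
    intro u
    by_cases h : ∃ σ' < (Order.succ μ).ord, EvBelow κ.ord fun i => ∀ η ∈ u, f η i ≤ f σ' i
    · exact ⟨h.choose, h.choose_spec.1, fun _ => h.choose_spec.2⟩
    · exact ⟨0, hc0, fun h' => absurd h' h⟩
  choose σ hσ hσ' using hσ
  obtain ⟨ξ, hξ, hξmono, hξΨ, hξcont⟩ := exists_continuous_sequence hc (ρ := ρ.ord)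
    (by rwa [card_ord]) C (fun u => nx (σ u)) fun u => hnx _ (hσ u)
  obtain ⟨b, hb, hb'⟩ := (sizeLE_Iio_ord ρ).exists_bound_image (o := (Order.succ μ).ord)
    (by rwa [hc.cof_ord]) hξ
  have hbdd : BddAbove (ξ '' Iio ρ.ord) := ⟨b, by rintro _ ⟨ν, hν, rfl⟩; exact (hb' ν hν).le⟩
  have hρlim : ∀ x < ρ.ord, x + 1 < ρ.ord := fun x hx =>
    succ_lt_of_aleph0_le_cof (by rw [hρr.cof_ord]; exact hρr.aleph0_le) hx
  set δ := sSup (ξ '' Iio ρ.ord) with hδdef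
  have hδ : ∀ ν < ρ.ord, ξ ν < δ := fun ν hν =>
    (hξmono ν (ν + 1) (Order.lt_add_one_iff.2 le_rfl) (hρlim ν hν)).trans_le
      (le_csSup hbdd ⟨ν + 1, hρlim ν hν, rfl⟩)
  have hδ' : ∀ x < δ, ∃ ν < ρ.ord, x < ξ ν := fun x hx => by
    obtain ⟨_, ⟨ν, hν, rfl⟩, h⟩ := exists_lt_of_lt_csSup' hx
    exact ⟨ν, hν, h⟩
  have hδc : δ < (Order.succ μ).ord := lt_of_le_of_lt
    (csSup_le' (by rintro _ ⟨ν, hν, rfl⟩; exact (hb' ν hν).le)) hb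
  have hδcof : δ.cof ≤ ρ := cof_le_of_unbounded ((sizeLE_Iio_ord ρ).image ξ)
    (by rintro _ ⟨ν, hν, rfl⟩; exact hδ ν hν) fun x hx =>
      let ⟨ν, hν, h⟩ := hδ' x hx
      ⟨ξ ν, ⟨ν, hν, rfl⟩, h.le⟩
  obtain ⟨α, hα, hαθ, hCα, hCu⟩ := hC _ (isClubIn_preimage hρr hρu hξmono hξcont hδ hδ'
    (hf.E_closed δ) (hf.E_unbdd δ))
  have hσν : ∀ ν, EvBelow κ.ord fun i => ∀ η ∈ C α ∩ Iic ν,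
      f (ξ η) i ≤ f (σ (ξ '' (C α ∩ Iic ν))) i := by
    intro ν
    refine (hσ' _ ⟨δ, hδc, (hf.n_cofinal ρ hρμ).mono fun i hi hρi => ?_⟩).mono fun i _ h η hη =>
      h _ ⟨η, hη, rfl⟩
    rintro _ ⟨η, hη, rfl⟩
    exact (hf.f_lt_of_mem δ hδc i hi (hδcof.trans hρi) _ (hCα hη.1).2.2).le
  have hsucc : ∀ ν ∈ C α, ∃ ν' ∈ C α, ν < ν' ∧ ∀ z ∈ C α, ν < z → ν' ≤ z := by
    intro ν hν
    obtain ⟨y, hy, hνy⟩ := hCu (ν + 1) (succ_lt_of_aleph0_le_cof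
      (by rw [hαθ]; exact hθr.aleph0_le) (hCα hν).1)
    exact ⟨_, isLeast_csInf_inter_Ioi hy (Order.add_one_le_iff.1 hνy)⟩
  choose! nu hnu hnu' hnu'' using hsucc
  have hpick : ∀ ν ∈ C α, ∃ i ∈ Iio κ.ord, (∀ η ∈ C α ∩ Iic ν,
      f (ξ η) i ≤ f (σ (ξ '' (C α ∩ Iic ν))) i) ∧ ∃ s ∈ S i,
        f (σ (ξ '' (C α ∩ Iic ν))) i ≤ s ∧ s < f (ξ (nu ν)) i := by
    intro ν hν
    have h1 := hnu ν hν
    have h2 : nu ν < ρ.ord := (hCα h1).2.1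
    obtain ⟨i0, hi0, h⟩ := (hσν ν).and (hf.f_strict _ _
      (hξΨ ν (nu ν) (hnu' ν hν) h2 α hα) (hξ _ h2))
    obtain ⟨i, hi, hiK, s, hs, hs1, hs2⟩ := hnxS _ (hσ (ξ '' (C α ∩ Iic ν))) i0 hi0
    obtain ⟨h3, h4⟩ := h i hi hiK
    exact ⟨i, hiK, h3, s, hs, hs1, hs2.trans h4⟩
  have hκθ : κ < α.cof := by rw [hαθ]; exact hκτ.trans_lt (Order.lt_succ τ)
  obtain ⟨i, hi, hU⟩ := exists_unbounded_fiber (U := C α) (sizeLE_Iio_ord κ) hκθ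
    (fun x hx => let ⟨y, hy, hxy⟩ := hCu x hx
      ⟨y, hy, hxy, (hCα hy).1⟩) fun ν hν _ => hpick ν hν
  choose! s hsS hs1 hs2 using fun ν (h : (∀ η ∈ C α ∩ Iic ν,
      f (ξ η) i ≤ f (σ (ξ '' (C α ∩ Iic ν))) i) ∧ ∃ s ∈ S i,
        f (σ (ξ '' (C α ∩ Iic ν))) i ≤ s ∧ s < f (ξ (nu ν)) i) => h.2
  set U : Set Ordinal.{0} := {ν | ν ∈ C α ∧ (∀ η ∈ C α ∩ Iic ν,
      f (ξ η) i ≤ f (σ (ξ '' (C α ∩ Iic ν))) i) ∧ ∃ s ∈ S i,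
        f (σ (ξ '' (C α ∩ Iic ν))) i ≤ s ∧ s < f (ξ (nu ν)) i} with hUdef
  have hsmono : StrictMonoOn s U := fun ν hν ν' hν' hlt =>
    (hs2 ν hν.2).trans_le ((hν'.2.1 _ ⟨hnu ν hν.1, hnu'' ν hν.1 ν' hν'.1 hlt⟩).trans (hs1 ν' hν'.2))
  have hUτ : SizeLE U τ := by
    unfold SizeLE
    rw [← mk_image_eq_of_injOn _ _ hsmono.injOn]
    refine (hS i hi).mono ?_ le_rfl
    rintro _ ⟨ν, hν, rfl⟩
    exact hsS ν hν.2
  have hle : α.cof ≤ τ := cof_le_of_unbounded hUτ (fun ν hν => (hCα hν.1).1) fun x hx => by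
    obtain ⟨ν, h1, h2, h3, h4⟩ := hU x hx
    exact ⟨ν, ⟨h1, h4⟩, h2⟩
  rw [hαθ] at hle
  exact hle.not_gt (Order.lt_succ τ)

/-! ### Exact upper bounds and scales -/

/-- `g` eventually dominates every function `f α`, `α < lam`. -/
def IsEvBound (K lam : Ordinal.{0}) (f : Ordinal.{0} → Ordinal.{0} → Ordinal.{0})
    (g : Ordinal.{0} → Ordinal.{0}) : Prop :=
  ∀ α < lam, EvBelow K fun i => f α i < g i

theorem Climbing.isEvBound_of_le {κ μ : Cardinal.{0}} (hμ : ℵ₀ ≤ μ)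
    {n : Ordinal.{0} → Cardinal.{0}} {E : Ordinal.{0} → Set Ordinal.{0}}
    {f : Ordinal.{0} → Ordinal.{0} → Ordinal.{0}} (hf : Climbing κ μ n E f)
    {g : Ordinal.{0} → Ordinal.{0}} {α0 : Ordinal.{0}} (hα0 : α0 < (Order.succ μ).ord)
    (h : ∀ α, α0 ≤ α → α < (Order.succ μ).ord → EvBelow κ.ord fun i => f α i ≤ g i) :
    IsEvBound κ.ord (Order.succ μ).ord f g := by
  intro α hα
  have hc : (Order.succ μ).IsRegular := isRegular_succ hμ
  have h1 : max α α0 + 1 < (Order.succ μ).ord :=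
    succ_lt_of_aleph0_le_cof (by rw [hc.cof_ord]; exact hc.aleph0_le) (max_lt hα hα0)
  have h2 : max α α0 < max α α0 + 1 := Order.lt_add_one_iff.2 le_rfl
  refine ((hf.f_strict α _ ((le_max_left _ _).trans_lt h2) h1).and
    (h _ ((le_max_right _ _).trans h2.le) h1)).mono fun i _ hi => hi.1.trans_le hi.2

theorem Climbing.exists_smaller_bound {κ μ : Cardinal.{0}} (hκ : ℵ₀ ≤ κ) (hcof : μ.ord.cof = κ)
    (hκμ : κ < μ) {n : Ordinal.{0} → Cardinal.{0}} {E : Ordinal.{0} → Set Ordinal.{0}}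
    {f : Ordinal.{0} → Ordinal.{0} → Ordinal.{0}} (hf : Climbing κ μ n E f)
    {g : Ordinal.{0} → Ordinal.{0}} (hg : IsEvBound κ.ord (Order.succ μ).ord f g)
    {d : Ordinal.{0} → Ordinal.{0}} (hd : EvBelow κ.ord fun i => d i < g i)
    (hd' : ∀ α < (Order.succ μ).ord, ¬ EvBelow κ.ord fun i => d i < f α i) :
    ∃ g', IsEvBound κ.ord (Order.succ μ).ord f g' ∧ (∀ i, g' i ≤ g i) ∧
      ¬ EvBelow κ.ord fun i => g i ≤ g' i := by
  have hμ : ℵ₀ ≤ μ := hκ.trans hκμ.le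
  have hκr := isRegular_cof (isSuccLimit_ord hμ)
  rw [hcof] at hκr
  have hK0 : 0 < κ.ord := pos_of_aleph0_le_cof (by rwa [hκr.cof_ord])
  obtain ⟨α0, hα0, h⟩ := hf.exists_stable_crossing hκ hcof hκμ le_rfl hκμ (S := fun i => {d i})
    fun i _ => sizeLE_singleton hκ
  classical
  refine ⟨fun i => if d i < f α0 i then g i else min (g i) (d i),
    hf.isEvBound_of_le hμ hα0 fun α hα hαc => ?_, fun i => ?_, fun hle => ?_⟩
  · refine ((h α hα hαc).and (hg α hαc)).mono fun i _ hi => ?_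
    split_ifs with hlt
    · exact hi.2.le
    · refine le_min hi.2.le ?_
      by_contra! h'
      exact hlt (hi.1 _ rfl h')
  · dsimp only
    split_ifs
    · exact le_rfl
    · exact min_le_left _ _
  · refine hd' α0 hα0 ((hle.and hd).mono fun i _ hi => ?_)
    by_contra hlt
    have h1 := hi.1
    simp only [if_neg hlt] at h1
    exact (h1.trans (min_le_right _ _)).not_gt hi.2

theorem Climbing.exists_exact_bound {κ μ : Cardinal.{0}} (hκ : ℵ₀ ≤ κ) (hcof : μ.ord.cof = κ)
    (hκμ : κ < μ) {n : Ordinal.{0} → Cardinal.{0}} {E : Ordinal.{0} → Set Ordinal.{0}}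
    {f : Ordinal.{0} → Ordinal.{0} → Ordinal.{0}} (hf : Climbing κ μ n E f) :
    ∃ g, IsEvBound κ.ord (Order.succ μ).ord f g ∧ (∀ i < κ.ord, g i ≤ (Order.succ (n i)).ord) ∧
      ∀ d : Ordinal.{0} → Ordinal.{0}, EvBelow κ.ord (fun i => d i < g i) →
        ∃ α < (Order.succ μ).ord, EvBelow κ.ord fun i => d i < f α i := by
  have hμ : ℵ₀ ≤ μ := hκ.trans hκμ.le
  have hκr := isRegular_cof (isSuccLimit_ord hμ)
  rw [hcof] at hκr
  have hK0 : 0 < κ.ord := pos_of_aleph0_le_cof (by rwa [hκr.cof_ord])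
  have hc : (Order.succ μ).IsRegular := isRegular_succ hμ
  have hκc : Order.succ κ < Order.succ μ :=
    (succ_lt_of_cof_lt hμ (by rwa [hcof]) hκμ).trans (Order.lt_succ μ)
  have hsr : (Order.succ κ).IsRegular := isRegular_succ hκ
  by_contra! hcon
  let N : Ordinal.{0} → Ordinal.{0} := fun i => (Order.succ (n i)).ord
  let S : Ordinal.{0} → (Ordinal.{0} → Ordinal.{0} → Ordinal.{0}) → Ordinal.{0} →
    Set Ordinal.{0} := fun ξ G i => {N i} ∪ (fun η => G η i) '' Iio ξ
  let M : Ordinal.{0} → (Ordinal.{0} → Ordinal.{0} → Ordinal.{0}) → Ordinal.{0} → Ordinal.{0} →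
    Ordinal.{0} := fun ξ G α i => sInf (S ξ G i ∩ Ici (f α i))
  have hNmem : ∀ ξ G α i, α < (Order.succ μ).ord → i < κ.ord → N i ∈ S ξ G i ∩ Ici (f α i) :=
    fun ξ G α i hα hi => ⟨Or.inl rfl, (hf.f_lt α hα i hi).le⟩
  obtain ⟨G, hG⟩ := exists_rec (X := Ordinal.{0} → Ordinal.{0})
    (fun ξ G b => ξ < (Order.succ κ).ord →
      IsEvBound κ.ord (Order.succ μ).ord f b ∧ ∃ α0 < (Order.succ μ).ord, ∀ α, α0 ≤ α →
        α < (Order.succ μ).ord → ¬ EvBelow κ.ord fun i => M ξ G α i ≤ b i) (fun ξ G => by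
      by_cases hξ : ξ < (Order.succ κ).ord
      swap
      · exact ⟨G 0, fun h => absurd h hξ⟩
      obtain ⟨α0, hα0, h⟩ := hf.exists_stable_crossing hκ hcof hκμ le_rfl hκμ (S := S ξ G)
        fun i _ => sizeLE_union hκ (sizeLE_singleton hκ)
          (((sizeLE_Iio ξ).mono subset_rfl (Order.lt_succ_iff.1 (lt_ord.1 hξ))).image _)
      have hM : ∀ α, α0 ≤ α → α < (Order.succ μ).ord →
          EvBelow κ.ord fun i => M ξ G α i = M ξ G α0 i := fun α hα hαc =>
        ((h α hα hαc).and (hf.mono hK0 hα hαc)).mono fun i _ hi => by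
          have : S ξ G i ∩ Ici (f α i) = S ξ G i ∩ Ici (f α0 i) := by
            ext s
            refine ⟨fun hs => ⟨hs.1, hi.2.trans hs.2⟩, fun hs => ⟨hs.1, ?_⟩⟩
            by_contra! hlt
            exact (hi.1 s hs.1 (not_le.1 hlt)).not_ge hs.2
          simp only [M, this]
      have hg0 : IsEvBound κ.ord (Order.succ μ).ord f (M ξ G α0) :=
        hf.isEvBound_of_le hμ hα0 fun α hα hαc => (hM α hα hαc).mono fun i hi heq => by
          rw [← heq]
          exact (csInf_mem ⟨_, hNmem ξ G α i hαc hi⟩).2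
      obtain ⟨d, hd, hd'⟩ := hcon (M ξ G α0) hg0 fun i hi => csInf_le' (hNmem ξ G α0 i hα0 hi)
      obtain ⟨b, hb, -, hb'⟩ := hf.exists_smaller_bound hκ hcof hκμ hg0 hd hd'
      refine ⟨b, fun _ => ⟨hb, α0, hα0, fun α hα hαc hle => hb' ?_⟩⟩
      exact (hle.and (hM α hα hαc)).mono fun i _ hi => hi.2 ▸ hi.1) (by
      intro ξ G G' b hGG hb hξ
      have hS : ∀ i, S ξ G i = S ξ G' i := fun i => by
        simp only [S]
        congr 1
        exact image_congr fun η hη => by rw [hGG η hη]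
      have hM : ∀ α i, M ξ G' α i = M ξ G α i := fun α i => by simp only [M, hS]
      simpa only [hM] using hb hξ)
  obtain ⟨α, hα, hα'⟩ := (sizeLE_Iio_ord (Order.succ κ)).exists_bound_choice
    (by rwa [hc.cof_ord]) fun ξ hξ => (hG ξ hξ).2
  have hs0 : 0 < (Order.succ κ).ord :=
    pos_of_aleph0_le_cof (by rw [hsr.cof_ord]; exact hsr.aleph0_le)
  have hSmono : ∀ ξ ξ' i, ξ ≤ ξ' → S ξ G i ⊆ S ξ' G i := fun ξ ξ' i h =>
    union_subset_union_right _ (image_mono (Iio_subset_Iio h))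
  obtain ⟨b, hb, hb'⟩ := (sizeLE_Iio_ord κ).exists_bound_choice (o := (Order.succ κ).ord)
    (by rw [hsr.cof_ord]; exact Order.lt_succ κ) fun i hi =>
      exists_stable (fun ξ => M ξ G α i) hs0 fun k l hkl _ =>
        csInf_le_csInf' ⟨_, hNmem k G α i hα hi⟩ (inter_subset_inter_left _ (hSmono k l i hkl))
  have hb1 : b + 1 < (Order.succ κ).ord :=
    succ_lt_of_aleph0_le_cof (by rw [hsr.cof_ord]; exact hsr.aleph0_le) hb
  have hbb : b < b + 1 := Order.lt_add_one_iff.2 le_rfl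
  obtain ⟨α1, hα1, hα1'⟩ := hα' b hb
  refine hα1' α hα1.le hα (((hG b hb).1 α hα).mono fun i hi hlt => ?_)
  obtain ⟨k0, hk0, hst⟩ := hb' i hi
  have heq : M b G α i = M (b + 1) G α i :=
    (hst b hk0.le hb).trans (hst (b + 1) (hk0.trans hbb).le hb1).symm
  rw [heq]
  exact csInf_le' ⟨Or.inr ⟨b, hbb, rfl⟩, hlt.le⟩

theorem Climbing.lt_cof_exact_bound {κ μ : Cardinal.{0}} (hκ : ℵ₀ ≤ κ) (hcof : μ.ord.cof = κ)
    (hκμ : κ < μ) {n : Ordinal.{0} → Cardinal.{0}} {E : Ordinal.{0} → Set Ordinal.{0}}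
    {f : Ordinal.{0} → Ordinal.{0} → Ordinal.{0}} (hf : Climbing κ μ n E f)
    {g : Ordinal.{0} → Ordinal.{0}} (hg : IsEvBound κ.ord (Order.succ μ).ord f g)
    (hexact : ∀ d : Ordinal.{0} → Ordinal.{0}, EvBelow κ.ord (fun i => d i < g i) →
      ∃ α < (Order.succ μ).ord, EvBelow κ.ord fun i => d i < f α i)
    {τ : Cardinal.{0}} (hκτ : κ ≤ τ) (hτμ : τ < μ) : EvBelow κ.ord fun i => τ < (g i).cof := by
  have hμ : ℵ₀ ≤ μ := hκ.trans hκμ.le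
  have hκr := isRegular_cof (isSuccLimit_ord hμ)
  rw [hcof] at hκr
  have hK0 : 0 < κ.ord := pos_of_aleph0_le_cof (by rwa [hκr.cof_ord])
  obtain ⟨α0, hα0, h⟩ := hf.exists_stable_crossing hκ hcof hκμ hκτ hτμ
    (S := fun i => {y | y ∈ ladder (g i) ∧ (g i).cof ≤ τ}) fun i _ => by
      by_cases hi : (g i).cof ≤ τ
      · exact (sizeLE_ladder (g i)).mono (fun y hy => hy.1) hi
      · exact (sizeLE_singleton (x := 0) (hκ.trans hκτ)).mono (fun y hy => absurd hy.2 hi) le_rfl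
  have hd : ∀ i, ∃ y, f α0 i < g i → y ∈ ladder (g i) ∧ f α0 i ≤ y := fun i => by
    by_cases hi : f α0 i < g i
    · obtain ⟨y, hy, hy'⟩ := exists_mem_ladder hi
      exact ⟨y, fun _ => ⟨hy, hy'⟩⟩
    · exact ⟨0, fun h => absurd h hi⟩
  choose d hd using hd
  obtain ⟨α, hα, hdα⟩ := hexact d ((hg α0 hα0).mono fun i _ hi => ladder_subset _ (hd i hi).1)
  have hm := max_lt hα hα0
  refine ((hg α0 hα0).and (hdα.and ((hf.mono hK0 (le_max_left α α0) hm).and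
    (h _ (le_max_right α α0) hm)))).mono fun i _ ⟨h1, h2, h3, h4⟩ => ?_
  by_contra! hle
  exact (h4 (d i) ⟨(hd i h1).1, hle⟩ (h2.trans_le h3)).not_ge (hd i h1).2

theorem exists_pscale {κ μ : Cardinal.{0}} (hκ : ℵ₀ ≤ κ) (hcof : μ.ord.cof = κ) (hκμ : κ < μ) :
    ∃ g f, PScale κ.ord (Order.succ μ).ord κ μ g f ∧ ∀ i < κ.ord, Order.succ κ ≤ (g i).cof := by
  obtain ⟨n, E, f, hf⟩ := exists_climbing hκ hcof hκμ
  obtain ⟨g, hg, hgn, hexact⟩ := hf.exists_exact_bound hκ hcof hκμ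
  have hμ : ℵ₀ ≤ μ := hκ.trans hκμ.le
  have hcofμ : μ.ord.cof < μ := by rwa [hcof]
  have hκr := isRegular_cof (isSuccLimit_ord hμ)
  rw [hcof] at hκr
  have hK0 : 0 < κ.ord := pos_of_aleph0_le_cof (by rwa [hκr.cof_ord])
  have hgcof : ∀ i < κ.ord, (g i).cof < μ := fun i hi => by
    refine ((cof_le_card _).trans (Ordinal.card_le_card (hgn i hi))).trans_lt ?_
    rw [card_ord]
    exact succ_lt_of_cof_lt hμ hcofμ (hf.n_lt i hi)
  obtain ⟨ι, hι⟩ := exists_rec (X := Ordinal.{0})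
    (fun i G b => i < κ.ord → (∀ j < i, G j < κ.ord) → b < κ.ord ∧ i ≤ b ∧ (∀ j < i, G j < b) ∧
      ∃ t, κ ≤ t ∧ n i ≤ t ∧ t < (g b).cof ∧ ∀ j < i, (g (G j)).cof ≤ t) (fun i G => by
      by_cases h : i < κ.ord ∧ ∀ j < i, G j < κ.ord
      swap
      · exact ⟨0, fun h1 h2 => absurd ⟨h1, h2⟩ h⟩
      obtain ⟨hi, hG⟩ := h
      have hiκ : i.card < κ := lt_ord.1 hi
      obtain ⟨b1, hb1, hb1'⟩ := (sizeLE_Iio i).exists_bound_image (o := κ.ord) (f := G)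
        (by rwa [hκr.cof_ord]) hG
      obtain ⟨b2, hb2, hb2'⟩ := (sizeLE_Iio i).exists_bound_image (o := μ.ord)
        (f := fun j => (g (G j)).cof.ord) (by rwa [hcof])
        fun j hj => ord_lt_ord.2 (hgcof _ (hG j hj))
      have ht : max κ (max (n i) b2.card) < μ := max_lt hκμ (max_lt (hf.n_lt i hi) (lt_ord.1 hb2))
      obtain ⟨i0, hi0, h⟩ := hf.lt_cof_exact_bound hκ hcof hκμ hg hexact (le_max_left κ _) ht
      have hb : max i0 (max i b1) < κ.ord := max_lt hi0 (max_lt hi hb1)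
      refine ⟨max i0 (max i b1), fun _ _ => ⟨hb, (le_max_left _ _).trans (le_max_right _ _),
        fun j hj => (hb1' j hj).trans_le ((le_max_right _ _).trans (le_max_right _ _)), _,
        le_max_left κ _, (le_max_left _ _).trans (le_max_right _ _), h _ (le_max_left _ _) hb,
        fun j hj => ?_⟩⟩
      refine (?_ : _ ≤ b2.card).trans ((le_max_right _ _).trans (le_max_right _ _))
      rw [← ord_le]
      exact (ord_le.2 (by simpa using Ordinal.card_le_card (hb2' j hj).le))) (by
      intro i G G' b hGG hb hi hG'
      have h := hb hi fun j hj => by rw [hGG j hj]; exact hG' j hj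
      refine ⟨h.1, h.2.1, fun j hj => hGG j hj ▸ h.2.2.1 j hj, ?_⟩
      obtain ⟨t, h1, h2, h3, h4⟩ := h.2.2.2
      exact ⟨t, h1, h2, h3, fun j hj => hGG j hj ▸ h4 j hj⟩)
  have hιK : ∀ i, i < κ.ord → ι i < κ.ord := by
    intro i
    induction i using WellFoundedLT.induction with
    | ind i ih => exact fun hi => (hι i hi fun j hj => ih j hj (hj.trans hi)).1
  have hι' := fun i (hi : i < κ.ord) => (hι i hi fun j hj => hιK j (hj.trans hi)).2
  have hev : ∀ {P : Ordinal.{0} → Prop}, EvBelow κ.ord P → EvBelow κ.ord fun i => P (ι i) :=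
    fun ⟨i0, h0, h⟩ => ⟨i0, h0, fun i hi hiK => h _ (hi.trans (hι' i hiK).1) (hιK i hiK)⟩
  have hκg : ∀ i < κ.ord, κ < (g (ι i)).cof := fun i hi => by
    obtain ⟨t, h1, -, h2, -⟩ := (hι' i hi).2.2
    exact h1.trans_lt h2
  have hιinj : InjOn ι (Iio κ.ord) :=
    StrictMonoOn.injOn fun i _ j hj hij => (hι' j hj).2.1 i hij
  classical
  refine ⟨fun i => g (ι i), fun α i => if f α (ι i) < g (ι i) then f α (ι i) else 0, ⟨?_, ?_, ?_,
    ?_, ?_, ?_⟩, fun i hi => Order.succ_le_of_lt (hκg i hi)⟩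
  · intro i hi
    obtain ⟨t, h1, -, h2, h3⟩ := (hι' i hi).2.2
    exact ⟨t, h1, h2, h3⟩
  · exact fun i hi => hgcof _ (hιK i hi)
  · intro t ht
    obtain ⟨i0, hi0, h⟩ := hf.n_cofinal t ht
    obtain ⟨t', -, h1, h2, -⟩ := (hι' i0 hi0).2.2
    exact ⟨i0, hi0, ((h i0 le_rfl hi0).trans h1).trans_lt h2⟩
  · intro α hα i hi
    split_ifs with h
    · exact h
    · exact pos_of_aleph0_le_cof (hκ.trans (hκg i hi).le)
  · intro α β hαβ hβ
    refine (hev ((hf.mono hK0 hαβ hβ).and (hg β hβ))).mono fun i _ h => ?_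
    rw [if_pos h.2, if_pos (h.1.trans_lt h.2)]
    exact h.1
  · intro d hd
    have hd' : EvBelow κ.ord fun j =>
        (if j ∈ ι '' Iio κ.ord then d (Function.invFunOn ι (Iio κ.ord) j) else f 0 j) < g j := by
      refine (hg 0 (hK0.trans ?_)).mono fun j hj h => ?_
      · exact ord_lt_ord.2 (hκμ.trans (Order.lt_succ μ))
      · split_ifs with hj'
        · obtain ⟨i, hi, rfl⟩ := hj'
          rw [hιinj.leftInvOn_invFunOn hi]
          exact hd i hi
        · exact h
    obtain ⟨α, hα, h⟩ := hexact _ hd'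
    refine ⟨α, hα, ((hev h).and (hev (hg α hα))).mono fun i hi h => ?_⟩
    have h1 := h.1
    rw [if_pos (show ι i ∈ ι '' Iio κ.ord from ⟨i, hi, rfl⟩), hιinj.leftInvOn_invFunOn (mem_Iio.2 hi)] at h1
    rwa [if_pos h.2]

/-! ### The equivalence -/

theorem Pr1With.exists_of_unbdd {mu theta : Cardinal.{0}} (hsing : _root_.IsSingular mu)
    {c : Ordinal.{0} → Ordinal.{0} → Ordinal.{0}} (h : Pr1With mu theta c)
    {A B : Set Ordinal.{0}} (hA : UnbddIn A (sucOrd mu)) (hB : UnbddIn B (sucOrd mu))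
    {ς : Ordinal.{0}} (hς : ς < theta.ord) : ∃ α ∈ A, ∃ β ∈ B, α < β ∧ c α β = ς := by
  have hr : (Order.succ mu).IsRegular := isRegular_succ hsing.1
  have hu : ℵ₀ < Order.succ mu := hsing.1.trans_lt (Order.lt_succ mu)
  have hκ : ℵ₀ ≤ mu.ord.cof := (isRegular_cof (isSuccLimit_ord hsing.1)).aleph0_le
  choose! p hpA hxp hp using hA
  choose! q hqB hxq hq using hB
  obtain ⟨h', h1, h2⟩ := exists_increasing (lam := sucOrd mu) (ρ := sucOrd mu)
    (fun ξ hξ => cof_ord_lt hr hξ) fun x hx => (isClubIn_closure_points hr hu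
      (F := fun x => max (p x) (q x)) fun x hx => max_lt (hp x hx) (hq x hx)).exists_gt hr hx
  have hlt : ∀ a b, a < b → b < sucOrd mu → p (h' a) < h' b ∧ q (h' a) < h' b := fun a b hab hb =>
    max_lt_iff.1 ((h1 b hb).1.2 _ (h2 a b hab hb))
  have hdisj : ∀ a b, a < b → b < sucOrd mu →
      Disjoint ({p (h' a), q (h' a)} : Set Ordinal.{0}) {p (h' b), q (h' b)} := by
    intro a b hab hb
    rw [disjoint_left]
    have hl := hlt a b hab hb
    have h3 := hxp _ (h1 b hb).2
    have h4 := hxq _ (h1 b hb).2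
    rintro x (rfl | rfl) (h | h)
    · exact (hl.1.trans_le h3).ne h
    · exact (hl.1.trans_le h4).ne h
    · exact (hl.2.trans_le h3).ne h
    · exact (hl.2.trans_le h4).ne h
  obtain ⟨a, b, hab, hb, hc⟩ := h.2 (fun a => {p (h' a), q (h' a)}) (fun a ha => by
      rintro x (rfl | rfl)
      · exact hp _ (h1 a ha).2
      · exact hq _ (h1 a ha).2) (fun a b ha hb hab => by
      rcases lt_or_gt_of_ne hab with h | h
      · exact hdisj a b h hb
      · exact (hdisj b a h ha).symm) (fun a _ => by
      unfold CardLT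
      refine lt_of_lt_of_le (lt_aleph0_iff_set_finite.2 ((finite_singleton _).insert _)) ?_
      rwa [aleph0_le_lift]) ς hς
  have hl : p (h' a) < q (h' b) := (hlt a b hab hb).1.trans_le (hxq _ (h1 b hb).2)
  have h3 := hc (p (h' a)) (Or.inl rfl) (q (h' b)) (Or.inr rfl)
  rw [min_eq_left hl.le, max_eq_right hl.le] at h3
  exact ⟨_, hpA _ (h1 a (hab.trans hb)).2, _, hqB _ (h1 b hb).2, hl, h3⟩

theorem pr1_of_forall_stationary {mu theta : Cardinal.{0}} (hsing : _root_.IsSingular mu)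
    {d : Ordinal.{0} → Ordinal.{0} → Ordinal.{0}}
    (hd : ∀ a b, a < b → b < sucOrd mu → d a b < theta.ord)
    (hdS : ∀ S T : Set Ordinal.{0}, IsStatIn S (sucOrd mu) → IsStatIn T (sucOrd mu) →
      ∀ ς, ς < theta.ord → ∃ α ∈ S, ∃ β ∈ T, α < β ∧ d α β = ς) : Pr1 mu theta := by
  have hκ : ℵ₀ ≤ mu.ord.cof := (isRegular_cof (isSuccLimit_ord hsing.1)).aleph0_le
  obtain ⟨g, f, hf, hg⟩ := exists_pscale hκ rfl hsing.2
  exact pr1_of_stationary hsing hf hg hd hdS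

end ColoringTransfer

/-- For singular `μ` and `θ ≤ μ⁺`, `pr₁(μ⁺,μ⁺,θ,cf μ)` is equivalent both to the existence of a
coloring realizing all colors on all pairs of unbounded sets, and to the existence of a coloring
realizing all colors on all pairs of stationary sets. -/
theorem stmt3 (mu theta : Cardinal) (hsing : IsSingular mu)
    (htheta : theta ≤ Order.succ mu) :
    (Pr1 mu theta ↔
      ∃ c : Ordinal → Ordinal → Ordinal,
        (∀ a b, a < b → b < sucOrd mu → c a b < theta.ord) ∧
        ∀ A B : Set Ordinal, A ⊆ Set.Iio (sucOrd mu) → B ⊆ Set.Iio (sucOrd mu) →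
          UnbddIn A (sucOrd mu) → UnbddIn B (sucOrd mu) →
          ∀ ς, ς < theta.ord → ∃ α ∈ A, ∃ β ∈ B, α < β ∧ c α β = ς) ∧
    (Pr1 mu theta ↔
      ∃ d : Ordinal → Ordinal → Ordinal,
        (∀ a b, a < b → b < sucOrd mu → d a b < theta.ord) ∧
        ∀ S T : Set Ordinal, IsStatIn S (sucOrd mu) → IsStatIn T (sucOrd mu) →
          ∀ ς, ς < theta.ord → ∃ α ∈ S, ∃ β ∈ T, α < β ∧ d α β = ς) := by
  have hr : (Order.succ mu).IsRegular := Cardinal.isRegular_succ hsing.1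
  refine ⟨⟨fun ⟨c, hc⟩ => ⟨c, hc.1, fun A B _ _ hA hB ς hς => hc.exists_of_unbdd hsing hA hB hς⟩,
    fun ⟨c, hc, h⟩ => pr1_of_forall_stationary hsing hc fun S T hS hT =>
      h S T hS.1 hT.1 (hS.unbddIn hr) (hT.unbddIn hr)⟩,
    ⟨fun ⟨c, hc⟩ => ⟨c, hc.1, fun S T hS hT ς hς =>
      hc.exists_of_unbdd hsing (hS.unbddIn hr) (hT.unbddIn hr) hς⟩,
    fun ⟨d, hd, h⟩ => pr1_of_forall_stationary hsing hd h⟩⟩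

end
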